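/- arXiv:1111.2850 — 2 statements merged into one kernel-verified Lean document; each statement's English description precedes it below -/
import Mathlib

section
/- Kato smoothing estimate (Proposition 3.1): there exists a constant C>0 such that for every Schwartz function φ on ℝ³ and every x ∈ ℝ, ( ∫_ℝ ∫_{ℝ²} |∇U(t)φ(x,y,z)|² dy dz dt )^{1/2} ≤ C ‖φ‖_{L²(ℝ³)}, where ∇U(t)φ(x̄) = ∫_{ℝ³} i ξ̄ e^{i(x̄·ξ̄ + tω(ξ̄))} φ̂(ξ̄) dξ̄ is the spatial gradient of U(t)φ. -/
open MeasureTheory Real Filter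
open scoped ENNReal

noncomputable section

/-- Euclidean dot product on ℝ³ (realized as ℝ × ℝ × ℝ). -/
def dot3 (a b : ℝ × ℝ × ℝ) : ℝ := a.1 * b.1 + a.2.1 * b.2.1 + a.2.2 * b.2.2

/-- Euclidean norm on ℝ³. -/
def en3 (ξ : ℝ × ℝ × ℝ) : ℝ := Real.sqrt (dot3 ξ ξ)

/-- The Zakharov–Kuznetsov dispersion relation ω(ξ,η,μ) = ξ(ξ²+η²+μ²). -/
def omega3 (ξ : ℝ × ℝ × ℝ) : ℝ := ξ.1 * (ξ.1 ^ 2 + ξ.2.1 ^ 2 + ξ.2.2 ^ 2)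

/-- Fourier transform on ℝ³, with normalization (2π)⁻³ ∫ e^{-i x·ξ} φ(x) dx. -/
def FT3 (φ : ℝ × ℝ × ℝ → ℂ) (ξ : ℝ × ℝ × ℝ) : ℂ :=
  ((((2 * π) ^ 3)⁻¹ : ℝ) : ℂ) * ∫ x : ℝ × ℝ × ℝ, Complex.exp (-Complex.I * (dot3 x ξ : ℂ)) * φ x

/-- Inverse Fourier transform on ℝ³: ∫ e^{i x·ξ} g(ξ) dξ. -/
def invFT3 (g : ℝ × ℝ × ℝ → ℂ) (x : ℝ × ℝ × ℝ) : ℂ :=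
  ∫ ξ : ℝ × ℝ × ℝ, Complex.exp (Complex.I * (dot3 x ξ : ℂ)) * g ξ

/-- The free Zakharov–Kuznetsov evolution U(t)φ(x̄) = ∫ e^{i(x̄·ξ̄ + tω(ξ̄))} φ̂(ξ̄) dξ̄. -/
def U3 (φ : ℝ × ℝ × ℝ → ℂ) (t : ℝ) (x : ℝ × ℝ × ℝ) : ℂ :=
  ∫ ξ : ℝ × ℝ × ℝ, Complex.exp (Complex.I * ((dot3 x ξ + t * omega3 ξ : ℝ) : ℂ)) * FT3 φ ξ

/-- L² norm on ℝ³. -/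
def L2norm3 (φ : ℝ × ℝ × ℝ → ℂ) : ℝ := Real.sqrt (∫ x : ℝ × ℝ × ℝ, ‖φ x‖ ^ 2)

/-- j-th coordinate of a point of ℝ³. -/
def coord3 (j : Fin 3) (ξ : ℝ × ℝ × ℝ) : ℝ := ![ξ.1, ξ.2.1, ξ.2.2] j

/-- Littlewood–Paley ring cutoff δ_k(ξ̄) = p(2^{-k-1}ξ̄) − p(2^{-k}ξ̄) on ℝ³. -/
def delta3 (p : ℝ × ℝ × ℝ → ℝ) (k : ℤ) (ξ : ℝ × ℝ × ℝ) : ℝ :=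
  p ((2:ℝ) ^ (-k-1) • ξ) - p ((2:ℝ) ^ (-k) • ξ)

/-- 1D rescaled cutoff p_k(ξ) = p(2^{-k}ξ). -/
def pk1 (p : ℝ → ℝ) (k : ℤ) (ξ : ℝ) : ℝ := p ((2:ℝ) ^ (-k) * ξ)

/-- 1D ring cutoff δ_k(ξ) = p(2^{-k-1}ξ) − p(2^{-k}ξ). -/
def dk1 (p : ℝ → ℝ) (k : ℤ) (ξ : ℝ) : ℝ := p ((2:ℝ) ^ (-k-1) * ξ) - p ((2:ℝ) ^ (-k) * ξ)

/-- Oscillatory integral I with three 1D symbols: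
I(t,x̄) = ∫ e^{i(x̄·ξ̄+tω(ξ̄))} ψ₁(ξ)ψ₂(η)ψ₃(μ) dξ̄. -/
def oscI (ψ₁ ψ₂ ψ₃ : ℝ → ℝ) (t : ℝ) (x : ℝ × ℝ × ℝ) : ℂ :=
  ∫ ξ : ℝ × ℝ × ℝ, Complex.exp (Complex.I * ((dot3 x ξ + t * omega3 ξ : ℝ) : ℂ)) *
    ((ψ₁ ξ.1 * ψ₂ ξ.2.1 * ψ₃ ξ.2.2 : ℝ) : ℂ)

/-- Frequency-side formula for the j-th component of ∇U(t)φ: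
∫ i ξ_j e^{i(x̄·ξ̄+tω(ξ̄))} φ̂(ξ̄) dξ̄. -/
def gradU3 (φ : ℝ × ℝ × ℝ → ℂ) (j : Fin 3) (t : ℝ) (x : ℝ × ℝ × ℝ) : ℂ :=
  ∫ ξ : ℝ × ℝ × ℝ, Complex.I * (coord3 j ξ : ℂ) *
    Complex.exp (Complex.I * ((dot3 x ξ + t * omega3 ξ : ℝ) : ℂ)) * FT3 φ ξ

instance isAddHaarMeasure_volume_prod3 :
    (volume : Measure (ℝ × ℝ × ℝ)).IsAddHaarMeasure :=
  Measure.prod.instIsAddHaarMeasure _ _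

/-- The Fourier transform of the one-dimensional Gaussian `exp (-b x²)`. -/
def gaussKernel (b s : ℝ) : ℝ := √(π / b) * Real.exp (-s ^ 2 / (4 * b))

/-- The tensor product of three copies of `gaussKernel`. -/
def gaussKernel3 (b : ℝ) (u : ℝ × ℝ × ℝ) : ℝ :=
  gaussKernel b u.1 * (gaussKernel b u.2.1 * gaussKernel b u.2.2)

lemma gaussKernel_nonneg (b s : ℝ) : 0 ≤ gaussKernel b s := by
  unfold gaussKernel; positivity

lemma continuous_gaussKernel (b : ℝ) : Continuous (gaussKernel b) := by
  unfold gaussKernel; fun_prop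

lemma gaussKernel3_nonneg (b : ℝ) (u : ℝ × ℝ × ℝ) : 0 ≤ gaussKernel3 b u :=
  mul_nonneg (gaussKernel_nonneg _ _) (mul_nonneg (gaussKernel_nonneg _ _) (gaussKernel_nonneg _ _))

lemma continuous_gaussKernel3 (b : ℝ) : Continuous (gaussKernel3 b) := by
  have := continuous_gaussKernel b
  unfold gaussKernel3; fun_prop

lemma integral_exp_mul_gaussian {b : ℝ} (hb : 0 < b) (s : ℝ) :
    ∫ x : ℝ, Complex.exp (Complex.I * ((x * s : ℝ) : ℂ)) * ((Real.exp (-b * x ^ 2) : ℝ) : ℂ)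
      = (gaussKernel b s : ℂ) := by
  have h := fourierIntegral_gaussian (b := (b : ℂ)) (by simpa using hb) (s : ℂ)
  rw [gaussKernel, Real.sqrt_eq_rpow]
  push_cast
  rw [Complex.ofReal_cpow (by positivity)]
  push_cast
  rw [← h]
  refine integral_congr_ae (Eventually.of_forall fun x => ?_)
  simp only
  congr 2
  ring

lemma lintegral_gaussKernel {b : ℝ} (hb : 0 < b) :
    ∫⁻ s : ℝ, ENNReal.ofReal (gaussKernel b s) = ENNReal.ofReal (2 * π) := by
  have hb' : 0 < 1 / (4 * b) := by positivity
  have he : ∀ s : ℝ, gaussKernel b s = √(π / b) * Real.exp (-(1 / (4 * b)) * s ^ 2) := by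
    intro s
    unfold gaussKernel
    congr 2
    ring
  rw [← ofReal_integral_eq_lintegral_ofReal]
  · congr 1
    simp_rw [he]
    rw [integral_const_mul, integral_gaussian, ← Real.sqrt_mul (by positivity)]
    have : π / b * (π / (1 / (4 * b))) = (2 * π) ^ 2 := by field_simp; ring
    rw [this, Real.sqrt_sq (by positivity)]
  · exact ((integrable_exp_neg_mul_sq hb').const_mul _).congr
      (Eventually.of_forall fun s => (he s).symm)
  · exact Eventually.of_forall fun s => gaussKernel_nonneg b s

lemma lintegral_gaussKernel3 {b : ℝ} (hb : 0 < b) :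
    ∫⁻ u : ℝ × ℝ × ℝ, ENNReal.ofReal (gaussKernel3 b u) = ENNReal.ofReal ((2 * π) ^ 3) := by
  have hm : AEMeasurable (fun s : ℝ => ENNReal.ofReal (gaussKernel b s)) :=
    (continuous_gaussKernel b).measurable.ennreal_ofReal.aemeasurable
  have hm2 : AEMeasurable (fun u : ℝ × ℝ =>
      ENNReal.ofReal (gaussKernel b u.1) * ENNReal.ofReal (gaussKernel b u.2)) := by
    have := (continuous_gaussKernel b).measurable
    fun_prop
  have he : ∀ u : ℝ × ℝ × ℝ, ENNReal.ofReal (gaussKernel3 b u)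
      = ENNReal.ofReal (gaussKernel b u.1) *
        (ENNReal.ofReal (gaussKernel b u.2.1) * ENNReal.ofReal (gaussKernel b u.2.2)) := by
    intro u
    rw [gaussKernel3, ENNReal.ofReal_mul (gaussKernel_nonneg _ _),
      ENNReal.ofReal_mul (gaussKernel_nonneg _ _)]
  simp_rw [he]
  rw [Measure.volume_eq_prod, lintegral_prod_mul hm hm2, Measure.volume_eq_prod,
    lintegral_prod_mul hm hm, lintegral_gaussKernel hb,
    ← ENNReal.ofReal_mul (by positivity), ← ENNReal.ofReal_mul (by positivity)]
  congr 1
  ring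

/-- The Gaussian weight `exp (-b |w|²)` on ℝ³. -/
def gaussWeight3 (b : ℝ) (w : ℝ × ℝ × ℝ) : ℝ :=
  Real.exp (-b * w.1 ^ 2) * (Real.exp (-b * w.2.1 ^ 2) * Real.exp (-b * w.2.2 ^ 2))

lemma gaussWeight3_nonneg (b : ℝ) (w : ℝ × ℝ × ℝ) : 0 ≤ gaussWeight3 b w := by
  unfold gaussWeight3; positivity

lemma continuous_gaussWeight3 (b : ℝ) : Continuous (gaussWeight3 b) := by
  unfold gaussWeight3; fun_prop

lemma integrable_gaussWeight3 {b : ℝ} (hb : 0 < b) : Integrable (gaussWeight3 b) := by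
  have h := integrable_exp_neg_mul_sq hb
  exact h.mul_prod (h.mul_prod h)

lemma integral_exp_mul_gaussWeight3 {b : ℝ} (hb : 0 < b) (u : ℝ × ℝ × ℝ) :
    ∫ w : ℝ × ℝ × ℝ, Complex.exp (Complex.I * (dot3 w u : ℂ)) * (gaussWeight3 b w : ℂ)
      = (gaussKernel3 b u : ℂ) := by
  have he : ∀ w : ℝ × ℝ × ℝ,
      Complex.exp (Complex.I * (dot3 w u : ℂ)) * (gaussWeight3 b w : ℂ)
      = (Complex.exp (Complex.I * ((w.1 * u.1 : ℝ) : ℂ)) * ((Real.exp (-b * w.1 ^ 2) : ℝ) : ℂ)) *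
       ((Complex.exp (Complex.I * ((w.2.1 * u.2.1 : ℝ) : ℂ)) *
          ((Real.exp (-b * w.2.1 ^ 2) : ℝ) : ℂ)) *
        (Complex.exp (Complex.I * ((w.2.2 * u.2.2 : ℝ) : ℂ)) *
          ((Real.exp (-b * w.2.2 ^ 2) : ℝ) : ℂ))) := by
    intro w
    simp only [dot3, gaussWeight3, Complex.ofReal_add, Complex.ofReal_mul, mul_add, Complex.exp_add]
    ring
  simp_rw [he]
  rw [Measure.volume_eq_prod, integral_prod_mul
    (fun x : ℝ => Complex.exp (Complex.I * ((x * u.1 : ℝ) : ℂ)) *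
      ((Real.exp (-b * x ^ 2) : ℝ) : ℂ))
    (fun q : ℝ × ℝ => (Complex.exp (Complex.I * ((q.1 * u.2.1 : ℝ) : ℂ)) *
          ((Real.exp (-b * q.1 ^ 2) : ℝ) : ℂ)) *
        (Complex.exp (Complex.I * ((q.2 * u.2.2 : ℝ) : ℂ)) *
          ((Real.exp (-b * q.2 ^ 2) : ℝ) : ℂ))),
    Measure.volume_eq_prod, integral_prod_mul
    (fun x : ℝ => Complex.exp (Complex.I * ((x * u.2.1 : ℝ) : ℂ)) *
      ((Real.exp (-b * x ^ 2) : ℝ) : ℂ))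
    (fun x : ℝ => Complex.exp (Complex.I * ((x * u.2.2 : ℝ) : ℂ)) *
      ((Real.exp (-b * x ^ 2) : ℝ) : ℂ)),
    integral_exp_mul_gaussian hb, integral_exp_mul_gaussian hb, integral_exp_mul_gaussian hb,
    gaussKernel3]
  push_cast
  rfl

lemma continuous_dot3 : Continuous fun p : (ℝ × ℝ × ℝ) × (ℝ × ℝ × ℝ) => dot3 p.1 p.2 := by
  unfold dot3; fun_prop

section Extension

variable {X : Type*} [MeasurableSpace X] {μ : Measure X}

/-- The extension operator `h ↦ ∫ e^{i w·Φ(v)} h(v) dμ(v)` attached to a map `Φ : X → ℝ³`. -/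
def extensionOp (μ : Measure X) (Φ : X → ℝ × ℝ × ℝ) (h : X → ℂ) (w : ℝ × ℝ × ℝ) : ℂ :=
  ∫ v, Complex.exp (Complex.I * (dot3 w (Φ v) : ℂ)) * h v ∂μ

lemma norm_exp_I_mul (r : ℝ) : ‖Complex.exp (Complex.I * (r : ℂ))‖ = 1 := by
  rw [mul_comm, Complex.norm_exp_ofReal_mul_I]

lemma measurable_exp_dot3 {Φ : X → ℝ × ℝ × ℝ} (hΦ : Measurable Φ) :
    Measurable fun p : (ℝ × ℝ × ℝ) × X => Complex.exp (Complex.I * (dot3 p.1 (Φ p.2) : ℂ)) := by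
  have : Measurable fun p : (ℝ × ℝ × ℝ) × X => dot3 p.1 (Φ p.2) :=
    continuous_dot3.measurable.comp (measurable_fst.prodMk (hΦ.comp measurable_snd))
  fun_prop

lemma measurable_extensionOp [SFinite μ] {Φ : X → ℝ × ℝ × ℝ} (hΦ : Measurable Φ) {h : X → ℂ}
    (hh : Measurable h) : Measurable (extensionOp μ Φ h) := by
  have : Measurable fun p : (ℝ × ℝ × ℝ) × X =>
      Complex.exp (Complex.I * (dot3 p.1 (Φ p.2) : ℂ)) * h p.2 :=
    (measurable_exp_dot3 hΦ).mul (hh.comp measurable_snd)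
  exact this.stronglyMeasurable.integral_prod_right.measurable

lemma extensionOp_eq_zero {Φ : X → ℝ × ℝ × ℝ} (hΦ : Measurable Φ) {h : X → ℂ}
    (hi : ¬ Integrable h μ) (w : ℝ × ℝ × ℝ) : extensionOp μ Φ h w = 0 := by
  refine integral_undef fun hc => hi ?_
  have hm : Measurable fun v => Complex.exp (Complex.I * ((-dot3 w (Φ v) : ℝ) : ℂ)) := by
    have : Measurable fun v => dot3 w (Φ v) :=
      continuous_dot3.measurable.comp (measurable_const.prodMk hΦ)
    fun_prop
  refine (hc.bdd_mul (c := 1) hm.aestronglyMeasurable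
    (Eventually.of_forall fun v => (norm_exp_I_mul _).le)).congr
    (Eventually.of_forall fun v => ?_)
  simp only
  rw [← mul_assoc, ← Complex.exp_add]
  simp

/-- Testing `|extensionOp μ Φ h|²` against a Gaussian gives a positive quadratic form in `h`. -/
lemma integral_norm_extensionOp_sq_mul_gaussWeight3 [SFinite μ] {b : ℝ} (hb : 0 < b) {Φ : X → ℝ × ℝ × ℝ}
    (hΦ : Measurable Φ) {h : X → ℂ} (hi : Integrable h μ) :
    ((∫ w, ‖extensionOp μ Φ h w‖ ^ 2 * gaussWeight3 b w : ℝ) : ℂ)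
      = ∫ p : X × X, h p.1 * (starRingEnd ℂ) (h p.2) * (gaussKernel3 b (Φ p.1 - Φ p.2) : ℂ)
          ∂(μ.prod μ) := by
  have hic : Integrable (fun v => (starRingEnd ℂ) (h v)) μ :=
    (Complex.conjLIE.toContinuousLinearEquiv.toContinuousLinearMap.integrable_comp hi)
  have hhh : Integrable (fun p : X × X => h p.1 * (starRingEnd ℂ) (h p.2)) (μ.prod μ) :=
    hi.mul_prod hic
  have hdiff : Measurable fun p : X × X => Φ p.1 - Φ p.2 :=
    (hΦ.comp measurable_fst).sub (hΦ.comp measurable_snd)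
  have hF : Integrable (fun q : (ℝ × ℝ × ℝ) × (X × X) =>
      Complex.exp (Complex.I * (dot3 q.1 (Φ q.2.1 - Φ q.2.2) : ℂ)) *
        ((gaussWeight3 b q.1 : ℂ) * (h q.2.1 * (starRingEnd ℂ) (h q.2.2))))
      (volume.prod (μ.prod μ)) := by
    refine Integrable.bdd_mul (c := 1) ?_ ?_ ?_
    · exact (integrable_gaussWeight3 hb).ofReal.mul_prod hhh
    · exact (measurable_exp_dot3 hdiff).aestronglyMeasurable
    · exact Eventually.of_forall fun q => (norm_exp_I_mul _).le
  have hsq : ∀ w, ((‖extensionOp μ Φ h w‖ ^ 2 * gaussWeight3 b w : ℝ) : ℂ)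
      = ∫ p : X × X, Complex.exp (Complex.I * (dot3 w (Φ p.1 - Φ p.2) : ℂ)) *
        ((gaussWeight3 b w : ℂ) * (h p.1 * (starRingEnd ℂ) (h p.2))) ∂(μ.prod μ) := by
    intro w
    push_cast
    rw [← Complex.mul_conj', extensionOp, ← integral_conj, ← integral_prod_mul,
      ← integral_mul_const]
    refine integral_congr_ae (Eventually.of_forall fun p => ?_)
    simp only [map_mul, ← Complex.exp_conj, Complex.conj_I, Complex.conj_ofReal]
    have : dot3 w (Φ p.1 - Φ p.2) = dot3 w (Φ p.1) - dot3 w (Φ p.2) := by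
      simp only [dot3, Prod.fst_sub, Prod.snd_sub]; ring
    rw [this]
    have he : Complex.exp (Complex.I * ((dot3 w (Φ p.1) - dot3 w (Φ p.2) : ℝ) : ℂ))
        = Complex.exp (Complex.I * (dot3 w (Φ p.1) : ℂ)) *
          Complex.exp (-Complex.I * (dot3 w (Φ p.2) : ℂ)) := by
      rw [← Complex.exp_add]; congr 1; push_cast; ring
    rw [he]
    ring
  rw [← integral_complex_ofReal]
  simp_rw [hsq]
  rw [integral_integral_swap hF]
  refine integral_congr_ae (Eventually.of_forall fun p => ?_)
  simp only
  rw [← integral_exp_mul_gaussWeight3 hb, ← integral_const_mul]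
  refine integral_congr_ae (Eventually.of_forall fun w => ?_)
  simp only
  ring

/-- Schur-type bound: if the push-forward of `J μ` under `Φ` is dominated by Lebesgue measure, the
Gaussian quadratic form is bounded by the weighted L² norm of `h`. -/
lemma lintegral_schur_le [SFinite μ] {b : ℝ} (hb : 0 < b) {Φ : X → ℝ × ℝ × ℝ} (hΦ : Measurable Φ) {h : X → ℂ}
    {J G : X → ℝ} (hJ : Measurable J) (hG : Measurable G) (hJ0 : ∀ v, 0 ≤ J v) (hG0 : ∀ v, 0 ≤ G v)
    (hhJG : ∀ v, ‖h v‖ ^ 2 ≤ J v * G v)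
    (hpush : ∀ k : ℝ × ℝ × ℝ → ℝ≥0∞, Measurable k →
      ∫⁻ v, ENNReal.ofReal (J v) * k (Φ v) ∂μ ≤ ∫⁻ u, k u) :
    ∫⁻ p : X × X, ENNReal.ofReal (‖h p.1‖ * ‖h p.2‖ * gaussKernel3 b (Φ p.1 - Φ p.2)) ∂(μ.prod μ)
      ≤ ENNReal.ofReal ((2 * π) ^ 3) * ∫⁻ v, ENNReal.ofReal (G v) ∂μ := by
  have hK : Measurable fun u => ENNReal.ofReal (gaussKernel3 b u) :=
    (continuous_gaussKernel3 b).measurable.ennreal_ofReal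
  have hdiff : Measurable fun p : X × X => Φ p.1 - Φ p.2 :=
    (hΦ.comp measurable_fst).sub (hΦ.comp measurable_snd)
  have hKd := hK.comp hdiff
  set A : X × X → ℝ≥0∞ := fun p =>
    ENNReal.ofReal (G p.1) * (ENNReal.ofReal (J p.2) *
      ENNReal.ofReal (gaussKernel3 b (Φ p.1 - Φ p.2))) with hA
  set B : X × X → ℝ≥0∞ := fun p =>
    ENNReal.ofReal (G p.2) * (ENNReal.ofReal (J p.1) *
      ENNReal.ofReal (gaussKernel3 b (Φ p.1 - Φ p.2))) with hB
  have hAm : Measurable A := by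
    refine Measurable.mul ?_ (Measurable.mul ?_ hKd) <;> fun_prop
  have hBm : Measurable B := by
    refine Measurable.mul ?_ (Measurable.mul ?_ hKd) <;> fun_prop
  set M := ENNReal.ofReal ((2 * π) ^ 3) * ∫⁻ v, ENNReal.ofReal (G v) ∂μ with hM
  have hAM : ∫⁻ p, A p ∂(μ.prod μ) ≤ M := by
    rw [lintegral_prod _ hAm.aemeasurable, hM, ← lintegral_const_mul _ hG.ennreal_ofReal]
    refine lintegral_mono fun v => ?_
    simp only [hA]
    rw [lintegral_const_mul' _ _ ENNReal.ofReal_ne_top, mul_comm]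
    gcongr
    refine (hpush (fun u => ENNReal.ofReal (gaussKernel3 b (Φ v - u)))
      (hK.comp (measurable_const.sub measurable_id))).trans ?_
    rw [lintegral_sub_left_eq_self (fun u => ENNReal.ofReal (gaussKernel3 b u)),
      lintegral_gaussKernel3 hb]
  have hBM : ∫⁻ p, B p ∂(μ.prod μ) ≤ M := by
    rw [lintegral_prod_symm _ hBm.aemeasurable, hM, ← lintegral_const_mul _ hG.ennreal_ofReal]
    refine lintegral_mono fun v => ?_
    simp only [hB]
    rw [lintegral_const_mul' _ _ ENNReal.ofReal_ne_top, mul_comm]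
    gcongr
    refine (hpush (fun u => ENNReal.ofReal (gaussKernel3 b (u - Φ v)))
      (hK.comp (measurable_id.sub measurable_const))).trans ?_
    rw [lintegral_sub_right_eq_self (fun u => ENNReal.ofReal (gaussKernel3 b u)),
      lintegral_gaussKernel3 hb]
  have hpt : ∀ p : X × X, ENNReal.ofReal (‖h p.1‖ * ‖h p.2‖ * gaussKernel3 b (Φ p.1 - Φ p.2))
      ≤ 2⁻¹ * (A p + B p) := by
    intro p
    have hk := gaussKernel3_nonneg b (Φ p.1 - Φ p.2)
    have h1 := hJ0 p.1
    have h2 := hJ0 p.2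
    have h3 := hG0 p.1
    have h4 := hG0 p.2
    have hle : ‖h p.1‖ * ‖h p.2‖ ≤ 2⁻¹ * (G p.1 * J p.2 + G p.2 * J p.1) := by
      refine le_of_sq_le_sq ?_ (by positivity)
      calc (‖h p.1‖ * ‖h p.2‖) ^ 2 = ‖h p.1‖ ^ 2 * ‖h p.2‖ ^ 2 := by ring
        _ ≤ (J p.1 * G p.1) * (J p.2 * G p.2) :=
          mul_le_mul (hhJG _) (hhJG _) (by positivity) (by positivity)
        _ ≤ _ := by nlinarith [sq_nonneg (G p.1 * J p.2 - G p.2 * J p.1)]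
    have h2' : (2⁻¹ : ℝ≥0∞) = ENNReal.ofReal 2⁻¹ := by
      rw [ENNReal.ofReal_inv_of_pos (by norm_num)]; simp
    simp only [hA, hB]
    rw [h2', ← ENNReal.ofReal_mul h2, ← ENNReal.ofReal_mul h1, ← ENNReal.ofReal_mul h3,
      ← ENNReal.ofReal_mul h4, ← ENNReal.ofReal_add (by positivity) (by positivity),
      ← ENNReal.ofReal_mul (by positivity)]
    refine ENNReal.ofReal_le_ofReal ((mul_le_mul_of_nonneg_right hle hk).trans_eq (by ring))
  calc _ ≤ ∫⁻ p, 2⁻¹ * (A p + B p) ∂(μ.prod μ) := lintegral_mono hpt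
    _ = 2⁻¹ * (∫⁻ p, A p ∂(μ.prod μ) + ∫⁻ p, B p ∂(μ.prod μ)) := by
      rw [lintegral_const_mul' _ _ (by simp), lintegral_add_left hAm]
    _ ≤ 2⁻¹ * (M + M) := by gcongr
    _ = M := by
      rw [← two_mul, ← mul_assoc, ENNReal.inv_mul_cancel (by simp) (by simp), one_mul]

lemma tendsto_gaussWeight3 (w : ℝ × ℝ × ℝ) :
    Tendsto (fun n : ℕ => gaussWeight3 (1 / ((n : ℝ) + 1)) w) atTop (nhds 1) := by
  have hc : Continuous fun b => gaussWeight3 b w := by unfold gaussWeight3; fun_prop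
  have h := (hc.tendsto 0).comp tendsto_one_div_add_atTop_nhds_zero_nat
  simpa [gaussWeight3, Function.comp_def] using h

/-- Plancherel-type upper bound for `extensionOp`. -/
theorem lintegral_norm_extensionOp_sq_le [SFinite μ] {Φ : X → ℝ × ℝ × ℝ} (hΦ : Measurable Φ) {h : X → ℂ}
    (hh : Measurable h) {J G : X → ℝ} (hJ : Measurable J) (hG : Measurable G)
    (hJ0 : ∀ v, 0 ≤ J v) (hG0 : ∀ v, 0 ≤ G v) (hhJG : ∀ v, ‖h v‖ ^ 2 ≤ J v * G v)
    (hpush : ∀ k : ℝ × ℝ × ℝ → ℝ≥0∞, Measurable k →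
      ∫⁻ v, ENNReal.ofReal (J v) * k (Φ v) ∂μ ≤ ∫⁻ u, k u) :
    ∫⁻ w, ENNReal.ofReal (‖extensionOp μ Φ h w‖ ^ 2)
      ≤ ENNReal.ofReal ((2 * π) ^ 3) * ∫⁻ v, ENNReal.ofReal (G v) ∂μ := by
  by_cases hi : Integrable h μ
  swap
  · simp [extensionOp_eq_zero hΦ hi]
  have hEm := measurable_extensionOp (μ := μ) hΦ hh
  have hbound : ∀ w, ‖extensionOp μ Φ h w‖ ≤ ∫ v, ‖h v‖ ∂μ := fun w =>
    (norm_integral_le_integral_norm _).trans_eq (by simp_rw [norm_mul, norm_exp_I_mul, one_mul])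
  have hmeas : ∀ b, Measurable fun w =>
      ENNReal.ofReal (‖extensionOp μ Φ h w‖ ^ 2 * gaussWeight3 b w) := fun b =>
    ((hEm.norm.pow_const 2).mul (continuous_gaussWeight3 b).measurable).ennreal_ofReal
  have hreg : ∀ b : ℝ, 0 < b →
      ∫⁻ w, ENNReal.ofReal (‖extensionOp μ Φ h w‖ ^ 2 * gaussWeight3 b w)
        ≤ ENNReal.ofReal ((2 * π) ^ 3) * ∫⁻ v, ENNReal.ofReal (G v) ∂μ := by
    intro b hb
    have hnn : ∀ w, 0 ≤ ‖extensionOp μ Φ h w‖ ^ 2 * gaussWeight3 b w := fun w =>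
      mul_nonneg (by positivity) (gaussWeight3_nonneg b w)
    rw [← ofReal_integral_eq_lintegral_ofReal ?_ (Eventually.of_forall hnn)]
    · have h1 := congrArg norm (integral_norm_extensionOp_sq_mul_gaussWeight3 hb hΦ hi)
      rw [Complex.norm_real, Real.norm_of_nonneg (integral_nonneg hnn)] at h1
      rw [h1, ofReal_norm]
      refine (enorm_integral_le_lintegral_enorm _).trans
        (le_trans (lintegral_mono fun p => ?_)
          (lintegral_schur_le hb hΦ hJ hG hJ0 hG0 hhJG hpush))
      rw [← ofReal_norm]
      simp [abs_of_nonneg (gaussKernel3_nonneg b (Φ p.1 - Φ p.2))]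
    · refine (integrable_gaussWeight3 hb).bdd_mul (c := (∫ v, ‖h v‖ ∂μ) ^ 2)
        (hEm.norm.pow_const 2).aestronglyMeasurable (Eventually.of_forall fun w => ?_)
      rw [norm_pow, norm_norm]
      exact pow_le_pow_left₀ (norm_nonneg _) (hbound w) 2
  calc ∫⁻ w, ENNReal.ofReal (‖extensionOp μ Φ h w‖ ^ 2)
      = ∫⁻ w, liminf (fun n : ℕ => ENNReal.ofReal
          (‖extensionOp μ Φ h w‖ ^ 2 * gaussWeight3 (1 / ((n : ℝ) + 1)) w)) atTop := by
        refine lintegral_congr fun w => (Tendsto.liminf_eq ?_).symm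
        have := ENNReal.tendsto_ofReal
          ((tendsto_gaussWeight3 w).const_mul (‖extensionOp μ Φ h w‖ ^ 2))
        rwa [mul_one] at this
    _ ≤ liminf (fun n : ℕ => ∫⁻ w, ENNReal.ofReal
          (‖extensionOp μ Φ h w‖ ^ 2 * gaussWeight3 (1 / ((n : ℝ) + 1)) w)) atTop :=
        lintegral_liminf_le fun n => hmeas _
    _ ≤ _ := by
        refine liminf_le_of_le (by isBoundedDefault) fun a ha => ?_
        obtain ⟨n, hn⟩ := ha.exists
        exact hn.trans (hreg _ (by positivity))

end Extension

lemma measurable_FT3 (φ : SchwartzMap (ℝ × ℝ × ℝ) ℂ) : Measurable (FT3 φ) := by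
  have hd : Measurable fun p : (ℝ × ℝ × ℝ) × (ℝ × ℝ × ℝ) => dot3 p.2 p.1 :=
    continuous_dot3.measurable.comp measurable_swap
  have : Measurable fun p : (ℝ × ℝ × ℝ) × (ℝ × ℝ × ℝ) =>
      Complex.exp (-Complex.I * (dot3 p.2 p.1 : ℂ)) * φ p.2 := by
    have := φ.continuous.measurable
    fun_prop
  exact (this.stronglyMeasurable.integral_prod_right.measurable).const_mul _

/-- Plancherel bound for `FT3`. -/
lemma lintegral_norm_FT3_sq_le (φ : SchwartzMap (ℝ × ℝ × ℝ) ℂ) :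
    ENNReal.ofReal ((2 * π) ^ 3) * ∫⁻ ξ, ENNReal.ofReal (‖FT3 φ ξ‖ ^ 2)
      ≤ ∫⁻ x, ENNReal.ofReal (‖φ x‖ ^ 2) := by
  have hφ := φ.continuous.measurable
  have h := lintegral_norm_extensionOp_sq_le (μ := (volume : Measure (ℝ × ℝ × ℝ)))
    (Φ := fun x => -x) measurable_neg (h := φ) hφ (J := fun _ => 1) (G := fun x => ‖φ x‖ ^ 2)
    measurable_const (hφ.norm.pow_const 2) (fun _ => zero_le_one) (fun _ => by positivity)
    (fun _ => by simp) (fun k _ => by simp [lintegral_neg_eq_self (μ := volume) k])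
  have he : ∀ ξ, ENNReal.ofReal (‖FT3 φ ξ‖ ^ 2) = ENNReal.ofReal ((((2 * π) ^ 3)⁻¹) ^ 2) *
      ENNReal.ofReal (‖extensionOp volume (fun x => -x) φ ξ‖ ^ 2) := by
    intro ξ
    have : FT3 φ ξ = ((((2 * π) ^ 3)⁻¹ : ℝ) : ℂ) * extensionOp volume (fun x => -x) φ ξ := by
      rw [FT3, extensionOp]
      congr 1
      refine integral_congr_ae (Eventually.of_forall fun x => ?_)
      simp only [dot3, Prod.fst_neg, Prod.snd_neg]
      congr 2
      push_cast
      ring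
    rw [this, norm_mul, mul_pow, Complex.norm_real, Real.norm_eq_abs, sq_abs,
      ENNReal.ofReal_mul (by positivity)]
  simp_rw [he]
  rw [lintegral_const_mul' _ _ ENNReal.ofReal_ne_top]
  calc _ ≤ ENNReal.ofReal ((2 * π) ^ 3) * (ENNReal.ofReal ((((2 * π) ^ 3)⁻¹) ^ 2) *
        (ENNReal.ofReal ((2 * π) ^ 3) * ∫⁻ x, ENNReal.ofReal (‖φ x‖ ^ 2))) := by gcongr
    _ = ∫⁻ x, ENNReal.ofReal (‖φ x‖ ^ 2) := by
      rw [← mul_assoc, ← mul_assoc, ← ENNReal.ofReal_mul (by positivity),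
        ← ENNReal.ofReal_mul (by positivity)]
      have : (2 * π) ^ 3 * (((2 * π) ^ 3)⁻¹) ^ 2 * (2 * π) ^ 3 = 1 := by
        field_simp
      rw [this, ENNReal.ofReal_one, one_mul]

/-- One-dimensional change of variables `τ = ω(ξ, η, μ)` at fixed `(η, μ)`. -/
lemma lintegral_deriv_omega3_mul_le (q : ℝ × ℝ) (k : ℝ → ℝ≥0∞) :
    ∫⁻ x : ℝ, ENNReal.ofReal (3 * x ^ 2 + q.1 ^ 2 + q.2 ^ 2) * k (omega3 (x, q))
      ≤ ∫⁻ s, k s := by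
  have hderiv : ∀ x ∈ (Set.univ : Set ℝ), HasDerivWithinAt (fun x : ℝ => omega3 (x, q))
      (3 * x ^ 2 + q.1 ^ 2 + q.2 ^ 2) Set.univ x := by
    intro x _
    have h1 : HasDerivAt (fun x : ℝ => x ^ 3 + (q.1 ^ 2 + q.2 ^ 2) * x)
        (3 * x ^ 2 + q.1 ^ 2 + q.2 ^ 2) x := by
      refine ((hasDerivAt_pow 3 x).add ((hasDerivAt_id x).const_mul _)).congr_deriv ?_
      norm_num
      ring
    refine (h1.congr_of_eventuallyEq (Eventually.of_forall fun y => ?_)).hasDerivWithinAt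
    simp only [omega3]
    ring
  have hinj : Set.InjOn (fun x : ℝ => omega3 (x, q)) Set.univ := by
    refine StrictMono.injective (fun x y hxy => ?_) |>.injOn
    have h3 : x ^ 3 < y ^ 3 := (Odd.strictMono_pow ⟨1, rfl⟩) hxy
    simp only [omega3]
    nlinarith [mul_le_mul_of_nonneg_left hxy.le (add_nonneg (sq_nonneg q.1) (sq_nonneg q.2))]
  have h := lintegral_image_eq_lintegral_abs_deriv_mul MeasurableSet.univ hderiv hinj k
  rw [setLIntegral_univ] at h
  calc _ = ∫⁻ x : ℝ, ENNReal.ofReal |3 * x ^ 2 + q.1 ^ 2 + q.2 ^ 2| * k (omega3 (x, q)) := by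
        refine lintegral_congr fun x => ?_
        rw [abs_of_nonneg (by positivity)]
    _ = _ := h.symm
    _ ≤ _ := setLIntegral_le_lintegral _ _

lemma continuous_omega3 : Continuous omega3 := by
  unfold omega3; fun_prop

lemma lintegral_jacobian_mul_le (k : ℝ × ℝ × ℝ → ℝ≥0∞) (hk : Measurable k) :
    ∫⁻ ξ : ℝ × ℝ × ℝ, ENNReal.ofReal (3 * ξ.1 ^ 2 + ξ.2.1 ^ 2 + ξ.2.2 ^ 2) * k (omega3 ξ, ξ.2)
      ≤ ∫⁻ u, k u := by
  have hω := continuous_omega3.measurable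
  have hm : Measurable fun ξ : ℝ × ℝ × ℝ =>
      ENNReal.ofReal (3 * ξ.1 ^ 2 + ξ.2.1 ^ 2 + ξ.2.2 ^ 2) * k (omega3 ξ, ξ.2) := by
    fun_prop
  rw [Measure.volume_eq_prod, lintegral_prod_symm _ hm.aemeasurable,
    lintegral_prod_symm _ hk.aemeasurable]
  exact lintegral_mono fun q => lintegral_deriv_omega3_mul_le q fun s => k (s, q)

lemma gradU3_eq_extensionOp (φ : ℝ × ℝ × ℝ → ℂ) (j : Fin 3) (x t y z : ℝ) :
    gradU3 φ j t (x, y, z) = extensionOp volume (fun ξ => (omega3 ξ, ξ.2))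
      (fun ξ => Complex.I * (coord3 j ξ : ℂ) * Complex.exp (Complex.I * ((x * ξ.1 : ℝ) : ℂ)) *
        FT3 φ ξ) (t, y, z) := by
  rw [gradU3, extensionOp]
  refine integral_congr_ae (Eventually.of_forall fun ξ => ?_)
  simp only
  have he : Complex.exp (Complex.I * ((dot3 (x, y, z) ξ + t * omega3 ξ : ℝ) : ℂ))
      = Complex.exp (Complex.I * (dot3 (t, y, z) (omega3 ξ, ξ.2) : ℂ)) *
        Complex.exp (Complex.I * ((x * ξ.1 : ℝ) : ℂ)) := by
    rw [← Complex.exp_add]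
    congr 1
    simp only [dot3]
    push_cast
    ring
  rw [he]
  ring

lemma coord3_sq_le (j : Fin 3) (ξ : ℝ × ℝ × ℝ) :
    coord3 j ξ ^ 2 ≤ 3 * ξ.1 ^ 2 + ξ.2.1 ^ 2 + ξ.2.2 ^ 2 := by
  fin_cases j <;> simp [coord3] <;>
    nlinarith [sq_nonneg ξ.1, sq_nonneg ξ.2.1, sq_nonneg ξ.2.2]

lemma measurable_coord3 (j : Fin 3) : Measurable (coord3 j) := by
  unfold coord3
  fin_cases j
  exacts [measurable_fst, measurable_snd.fst, measurable_snd.snd]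

lemma measurable_gradU3 (φ : SchwartzMap (ℝ × ℝ × ℝ) ℂ) (j : Fin 3) (x : ℝ) :
    Measurable fun w : ℝ × ℝ × ℝ => gradU3 φ j w.1 (x, w.2) := by
  have h1 := measurable_coord3 j
  have h2 := measurable_FT3 φ
  have hω := continuous_omega3.measurable
  have h := measurable_extensionOp (μ := (volume : Measure (ℝ × ℝ × ℝ)))
    (Φ := fun ξ => (omega3 ξ, ξ.2)) (by fun_prop)
    (h := fun ξ => Complex.I * (coord3 j ξ : ℂ) * Complex.exp (Complex.I * ((x * ξ.1 : ℝ) : ℂ)) *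
        FT3 φ ξ) (by fun_prop)
  convert h using 2 with w
  exact gradU3_eq_extensionOp φ j x w.1 w.2.1 w.2.2

/-- Kato smoothing for a single partial derivative. -/
lemma lintegral_norm_gradU3_sq_le (φ : SchwartzMap (ℝ × ℝ × ℝ) ℂ) (j : Fin 3) (x : ℝ) :
    ∫⁻ w : ℝ × ℝ × ℝ, ENNReal.ofReal (‖gradU3 φ j w.1 (x, w.2)‖ ^ 2)
      ≤ ∫⁻ v, ENNReal.ofReal (‖φ v‖ ^ 2) := by
  have h1 := measurable_coord3 j
  have h2 := measurable_FT3 φ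
  have hω := continuous_omega3.measurable
  have h := lintegral_norm_extensionOp_sq_le (μ := (volume : Measure (ℝ × ℝ × ℝ)))
    (Φ := fun ξ => (omega3 ξ, ξ.2)) (by fun_prop)
    (h := fun ξ => Complex.I * (coord3 j ξ : ℂ) * Complex.exp (Complex.I * ((x * ξ.1 : ℝ) : ℂ)) *
        FT3 φ ξ) (by fun_prop)
    (J := fun ξ => 3 * ξ.1 ^ 2 + ξ.2.1 ^ 2 + ξ.2.2 ^ 2) (G := fun ξ => ‖FT3 φ ξ‖ ^ 2)
    (by fun_prop) (by fun_prop) (fun _ => by positivity) (fun _ => by positivity)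
    (fun ξ => by
      rw [norm_mul, norm_mul, norm_exp_I_mul, norm_mul, Complex.norm_I, one_mul, mul_one,
        Complex.norm_real, mul_pow, Real.norm_eq_abs, sq_abs]
      exact mul_le_mul_of_nonneg_right (coord3_sq_le j ξ) (by positivity))
    lintegral_jacobian_mul_le
  refine le_trans (le_of_eq (lintegral_congr fun w => ?_)) (h.trans (lintegral_norm_FT3_sq_le φ))
  rw [← gradU3_eq_extensionOp φ j x w.1 w.2.1 w.2.2]

lemma ofReal_integral_le_lintegral {X : Type*} [MeasurableSpace X] {μ : Measure X} {f : X → ℝ}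
    (hf : ∀ v, 0 ≤ f v) : ENNReal.ofReal (∫ v, f v ∂μ) ≤ ∫⁻ v, ENNReal.ofReal (f v) ∂μ := by
  by_cases hi : Integrable f μ
  · exact (ofReal_integral_eq_lintegral_ofReal hi (Eventually.of_forall hf)).le
  · simp [integral_undef hi]

/-- Proposition 3.1 (Kato smoothing): ‖∇U(t)φ‖_{L^∞_x L²_{yzt}} ≲ ‖φ‖_{L²}. -/
theorem kato_smoothing :
    ∃ C : ℝ, 0 < C ∧ ∀ φ : SchwartzMap (ℝ × ℝ × ℝ) ℂ, ∀ x : ℝ,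
      Real.sqrt (∫ t : ℝ, ∫ y : ℝ, ∫ z : ℝ,
          ∑ j : Fin 3, ‖gradU3 (⇑φ) j t (x, y, z)‖ ^ 2)
        ≤ C * L2norm3 (⇑φ) := by
  refine ⟨√3, by positivity, fun φ x => ?_⟩
  rw [L2norm3, ← Real.sqrt_mul (by norm_num)]
  refine Real.sqrt_le_sqrt ?_
  set g : ℝ × ℝ × ℝ → ℝ := fun w => ∑ j : Fin 3, ‖gradU3 φ j w.1 (x, w.2)‖ ^ 2 with hg
  have hg0 : ∀ w, 0 ≤ g w := fun w => Finset.sum_nonneg fun j _ => by positivity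
  have hgm : Measurable g :=
    Finset.measurable_sum _ fun j _ => (measurable_gradU3 φ j x).norm.pow_const 2
  have hsq : Integrable (fun v => ‖φ v‖ ^ 2) := by
    simpa using (φ.memLp 2 volume).integrable_norm_pow (by norm_num)
  have hR : 0 ≤ ∫ v, ‖φ v‖ ^ 2 := integral_nonneg fun v => by positivity
  rw [← ENNReal.ofReal_le_ofReal_iff (by positivity)]
  calc ENNReal.ofReal (∫ t : ℝ, ∫ y : ℝ, ∫ z : ℝ, g (t, y, z))
      ≤ ∫⁻ t : ℝ, ∫⁻ y : ℝ, ∫⁻ z : ℝ, ENNReal.ofReal (g (t, y, z)) := by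
        refine (ofReal_integral_le_lintegral fun t => integral_nonneg fun y =>
          integral_nonneg fun z => hg0 _).trans (lintegral_mono fun t => ?_)
        refine (ofReal_integral_le_lintegral fun y =>
          integral_nonneg fun z => hg0 _).trans (lintegral_mono fun y => ?_)
        exact ofReal_integral_le_lintegral fun z => hg0 _
    _ = ∫⁻ w, ENNReal.ofReal (g w) := by
        rw [Measure.volume_eq_prod, lintegral_prod _ hgm.ennreal_ofReal.aemeasurable]
        refine lintegral_congr fun t => ?_
        exact (lintegral_prod (fun q => ENNReal.ofReal (g (t, q)))
          (hgm.ennreal_ofReal.comp measurable_prodMk_left).aemeasurable).symm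
    _ = ∑ j : Fin 3, ∫⁻ w : ℝ × ℝ × ℝ, ENNReal.ofReal (‖gradU3 φ j w.1 (x, w.2)‖ ^ 2) := by
        rw [← lintegral_finsetSum _ fun j _ =>
          ((measurable_gradU3 φ j x).norm.pow_const 2).ennreal_ofReal]
        exact lintegral_congr fun w => ENNReal.ofReal_sum_of_nonneg fun j _ => by positivity
    _ ≤ ∑ _j : Fin 3, ∫⁻ v, ENNReal.ofReal (‖φ v‖ ^ 2) :=
        Finset.sum_le_sum fun j _ => lintegral_norm_gradU3_sq_le φ j x
    _ = ENNReal.ofReal (3 * ∫ v, ‖φ v‖ ^ 2) := by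
        rw [Finset.sum_const, Finset.card_univ, Fintype.card_fin, nsmul_eq_mul,
          ← ofReal_integral_eq_lintegral_ofReal hsq (Eventually.of_forall fun v => by positivity),
          ENNReal.ofReal_mul (by norm_num)]
        simp
end
end

section
/- Unweighted oscillatory integral estimate with epsilon loss (Lemma of Section 3): for every ε>0 there exists C>0 such that for every T ∈ (0,1), every integer k ≥ 0, and each of the three choices (ψ₁,ψ₂,ψ₃) = (δ_k,p_k,p_k), (p_k,δ_k,p_k) or (p_k,p_k,δ_k), one has ∫_ℝ sup_{(y,z)∈ℝ², t∈[0,T]} |I_k(t,x,y,z)| dx ≤ C 2^{(2+ε)k}, where I_k(t,x̄) = ∫_{ℝ³} e^{i(x̄·ξ̄ + tω(ξ̄))} ψ₁(ξ) ψ₂(η) ψ₃(μ) dξ̄. -/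
open MeasureTheory Real Filter
open scoped ENNReal

noncomputable section

open scoped FourierTransform SchwartzMap in
theorem norm_fourier_cexp_quadratic_le {b : ℂ} (hb : 0 < b.re) (Y w : ℝ) :
    ‖𝓕 (fun η : ℝ => Complex.exp (-b * η ^ 2 + Complex.I * Y * η)) w‖ ≤ √(π / ‖b‖) := by
  have hb0 : b ≠ 0 := by rintro rfl; simp at hb
  have key : 𝓕 (fun η : ℝ => Complex.exp (-b * η ^ 2 + Complex.I * Y * η)) w =
      (π / b) ^ (1 / 2 : ℂ) * Complex.exp (-((Y - 2 * π * w : ℝ) : ℂ) ^ 2 / (4 * b)) := by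
    rw [← fourierIntegral_gaussian hb, Real.fourier_real_eq_integral_exp_smul]
    refine integral_congr_ae (.of_forall fun η => ?_)
    simp only [smul_eq_mul, ← Complex.exp_add]
    congr 1
    push_cast
    ring
  have hpow : ‖((π : ℂ) / b) ^ (1 / 2 : ℂ)‖ = √(π / ‖b‖) := by
    rw [show (1 / 2 : ℂ) = ((1 / 2 : ℝ) : ℂ) by norm_num, Complex.norm_cpow_real, norm_div,
      Complex.norm_real, Real.norm_of_nonneg pi_pos.le, Real.sqrt_eq_rpow]
  have hre : (-((Y - 2 * π * w : ℝ) : ℂ) ^ 2 / (4 * b)).re ≤ 0 := by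
    have h : -((Y - 2 * π * w : ℝ) : ℂ) ^ 2 / (4 * b) =
        ((-((Y - 2 * π * w) ^ 2 / 4) : ℝ) : ℂ) * b⁻¹ := by
      push_cast
      field_simp
    rw [h, Complex.re_ofReal_mul, Complex.inv_re]
    have : 0 ≤ b.re / Complex.normSq b := div_nonneg hb.le (Complex.normSq_nonneg b)
    nlinarith [sq_nonneg (Y - 2 * π * w)]
  rw [key, norm_mul, hpow, Complex.norm_exp]
  exact mul_le_of_le_one_right (Real.sqrt_nonneg _) (Real.exp_le_one_iff.2 hre)

open scoped FourierTransform SchwartzMap in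
theorem norm_integral_cexp_quadratic_mul_schwartz_le (F : 𝓢(ℝ, ℂ)) {b : ℂ} (hb : 0 < b.re)
    (Y : ℝ) :
    ‖∫ η : ℝ, Complex.exp (-b * η ^ 2 + Complex.I * Y * η) * F η‖
      ≤ √(π / ‖b‖) * ∫ w : ℝ, ‖(𝓕⁻ F : 𝓢(ℝ, ℂ)) w‖ := by
  have hg : Integrable fun η : ℝ => Complex.exp (-b * η ^ 2 + Complex.I * Y * η) := by
    simpa using integrable_cexp_quadratic hb (Complex.I * Y) 0
  have hflip := VectorFourier.integral_fourierIntegral_smul_eq_flip (L := innerₗ ℝ)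
    (μ := volume) (ν := volume) Real.continuous_fourierChar continuous_inner
    (𝓕⁻ F : 𝓢(ℝ, ℂ)).integrable hg
  have hF : ∀ ξ : ℝ, VectorFourier.fourierIntegral Real.fourierChar volume (innerₗ ℝ)
      (𝓕⁻ F : 𝓢(ℝ, ℂ)) ξ = F ξ := by
    intro ξ
    have hinv : 𝓕 (𝓕⁻ F : 𝓢(ℝ, ℂ)) = F := FourierTransform.fourier_fourierInv_eq F
    have h := congrArg (fun G : 𝓢(ℝ, ℂ) => G ξ) hinv
    simp only [SchwartzMap.fourier_coe] at h
    exact h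
  have hflip' : ∫ η : ℝ, Complex.exp (-b * η ^ 2 + Complex.I * Y * η) * F η =
      ∫ w : ℝ, (𝓕⁻ F : 𝓢(ℝ, ℂ)) w *
        𝓕 (fun η : ℝ => Complex.exp (-b * η ^ 2 + Complex.I * Y * η)) w := by
    simp only [hF, smul_eq_mul] at hflip
    simp_rw [mul_comm (Complex.exp _)]
    rw [hflip]
    congr! 3 with w
    simp [Real.fourier_eq, VectorFourier.fourierIntegral]
  rw [hflip', ← integral_const_mul]
  refine norm_integral_le_of_norm_le ((𝓕⁻ F : 𝓢(ℝ, ℂ)).integrable.norm.const_mul _)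
    (.of_forall fun w => ?_)
  rw [norm_mul, mul_comm]
  gcongr
  exact norm_fourier_cexp_quadratic_le hb Y w

open scoped ContDiff in
/-- Dispersive decay of the one-dimensional Schrödinger kernel with a smooth cutoff. -/
theorem exists_norm_integral_quadratic_phase_le {χ : ℝ → ℝ} (hχ : ContDiff ℝ ∞ χ)
    (hs : HasCompactSupport χ) :
    ∃ C : ℝ, 0 ≤ C ∧ ∀ a Y : ℝ, a ≠ 0 →
      ‖∫ η : ℝ, Complex.exp (Complex.I * ((Y * η + a * η ^ 2 : ℝ) : ℂ)) * (χ η : ℂ)‖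
        ≤ C * |a| ^ (-(1 / 2) : ℝ) := by
  have hs' : HasCompactSupport fun η => (χ η : ℂ) := hs.comp_left (g := ((↑) : ℝ → ℂ)) (by simp)
  have hχ' : ContDiff ℝ ∞ fun η => (χ η : ℂ) := Complex.ofRealCLM.contDiff.comp hχ
  let F := hs'.toSchwartzMap hχ'
  have hFval : ∀ η, F η = (χ η : ℂ) := fun η => rfl
  refine ⟨√π * ∫ w : ℝ, ‖(FourierTransformInv.fourierInv F : SchwartzMap ℝ ℂ) w‖, by positivity,
    fun a Y ha => ?_⟩
  have hlim : Tendsto (fun δ : ℝ => ∫ η : ℝ, Complex.exp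
        (-(δ - a * Complex.I) * η ^ 2 + Complex.I * Y * η) * F η) (nhdsWithin 0 (Set.Ioi 0))
      (nhds (∫ η : ℝ, Complex.exp (Complex.I * ((Y * η + a * η ^ 2 : ℝ) : ℂ)) * (χ η : ℂ))) := by
    refine tendsto_integral_filter_of_dominated_convergence (fun η => ‖F η‖)
      (.of_forall fun δ => ?_) ?_ F.integrable.norm (.of_forall fun η => ?_)
    · exact (Continuous.mul (by fun_prop) F.continuous).aestronglyMeasurable
    · filter_upwards [self_mem_nhdsWithin] with δ hδ
      refine .of_forall fun η => ?_
      rw [norm_mul, Complex.norm_exp]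
      refine mul_le_of_le_one_left (norm_nonneg _) (Real.exp_le_one_iff.2 ?_)
      have : (-(δ - a * Complex.I) * η ^ 2 + Complex.I * Y * η).re = -(δ * η ^ 2) := by
        simp [← Complex.ofReal_pow]
      rw [this]
      have : 0 < δ := hδ
      nlinarith [mul_nonneg this.le (sq_nonneg η)]
    · rw [hFval]
      refine Tendsto.mul_const _ (tendsto_nhdsWithin_of_tendsto_nhds ?_)
      have hc : Continuous fun δ : ℝ => Complex.exp
        (-(δ - a * Complex.I) * η ^ 2 + Complex.I * Y * η) := by fun_prop
      convert hc.tendsto 0 using 3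
      push_cast
      ring
  refine le_of_tendsto hlim.norm ?_
  filter_upwards [self_mem_nhdsWithin] with δ hδ
  have hδ : 0 < δ := hδ
  refine (norm_integral_cexp_quadratic_mul_schwartz_le F (by simpa using hδ) Y).trans ?_
  have hna : |a| ≤ ‖(δ : ℂ) - a * Complex.I‖ := by
    simpa using Complex.abs_im_le_norm ((δ : ℂ) - a * Complex.I)
  have ha' : 0 < |a| := abs_pos.2 ha
  have hsq : √(π / ‖(δ : ℂ) - a * Complex.I‖) ≤ √π * |a| ^ (-(1 / 2) : ℝ) := by
    rw [Real.rpow_neg ha'.le, ← Real.sqrt_eq_rpow, ← div_eq_mul_inv, ← Real.sqrt_div pi_pos.le]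
    gcongr
  calc _ ≤ (√π * |a| ^ (-(1 / 2) : ℝ)) * _ := by gcongr
    _ = _ := by ring

/-- Interpolation between the dispersive decay and the trivial bound. -/
theorem exists_norm_integral_quadratic_phase_le_rpow {χ : ℝ → ℝ} (hχ : ContDiff ℝ (⊤ : ℕ∞) χ)
    (hs : HasCompactSupport χ) {θ : ℝ} (hθ0 : 0 ≤ θ) (hθ : θ ≤ 1 / 2) :
    ∃ C : ℝ, 0 ≤ C ∧ ∀ a Y : ℝ, a ≠ 0 →
      ‖∫ η : ℝ, Complex.exp (Complex.I * ((Y * η + a * η ^ 2 : ℝ) : ℂ)) * (χ η : ℂ)‖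
        ≤ C * |a| ^ (-θ) := by
  obtain ⟨C, hC0, hC⟩ := exists_norm_integral_quadratic_phase_le hχ hs
  have hint : Integrable fun η => ‖χ η‖ := (hχ.continuous.integrable_of_hasCompactSupport hs).norm
  have hint0 : 0 ≤ ∫ η, ‖χ η‖ := by positivity
  refine ⟨C + ∫ η, ‖χ η‖, by positivity, fun a Y ha => ?_⟩
  have ha' : 0 < |a| := abs_pos.2 ha
  rcases le_total |a| 1 with h1 | h1
  · have hone : 1 ≤ |a| ^ (-θ) := Real.one_le_rpow_of_pos_of_le_one_of_nonpos ha' h1 (by linarith)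
    have : ‖∫ η : ℝ, Complex.exp (Complex.I * ((Y * η + a * η ^ 2 : ℝ) : ℂ)) * (χ η : ℂ)‖
        ≤ ∫ η, ‖χ η‖ := by
      refine norm_integral_le_of_norm_le hint (.of_forall fun η => ?_)
      rw [norm_mul, mul_comm Complex.I, Complex.norm_exp_ofReal_mul_I, one_mul, Complex.norm_real]
    nlinarith
  · refine (hC a Y ha).trans ?_
    have : |a| ^ (-(1 / 2) : ℝ) ≤ |a| ^ (-θ) :=
      Real.rpow_le_rpow_of_exponent_le h1 (by linarith)
    gcongr
    linarith

theorem intervalIntegral_cexp_mul_deriv_phase {a b : ℝ} {ψ ψ' u u' : ℝ → ℝ}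
    (hψ : ∀ x ∈ Set.uIcc a b, HasDerivAt ψ (ψ' x) x)
    (hu : ∀ x ∈ Set.uIcc a b, HasDerivAt u (u' x) x)
    (hψ'c : ContinuousOn ψ' (Set.uIcc a b)) (hu'c : ContinuousOn u' (Set.uIcc a b))
    (ha : u a = 0) (hb : u b = 0) :
    ∫ x in a..b, Complex.exp (Complex.I * (ψ x : ℂ)) * ((ψ' x * u x : ℝ) : ℂ) =
      Complex.I * ∫ x in a..b, Complex.exp (Complex.I * (ψ x : ℂ)) * (u' x : ℂ) := by
  have hψc : ContinuousOn ψ (Set.uIcc a b) := fun x hx => (hψ x hx).continuousAt.continuousWithinAt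
  have huc : ContinuousOn u (Set.uIcc a b) := fun x hx => (hu x hx).continuousAt.continuousWithinAt
  have hec : ContinuousOn (fun x => Complex.exp (Complex.I * (ψ x : ℂ))) (Set.uIcc a b) :=
    (continuousOn_const.mul (Complex.continuous_ofReal.comp_continuousOn hψc)).cexp
  have h1 : IntervalIntegrable
      (fun x => Complex.exp (Complex.I * (ψ x : ℂ)) * ((ψ' x * u x : ℝ) : ℂ)) volume a b :=
    (hec.mul (Complex.continuous_ofReal.comp_continuousOn (hψ'c.mul huc))).intervalIntegrable
  have h2 : IntervalIntegrable
      (fun x => Complex.exp (Complex.I * (ψ x : ℂ)) * (u' x : ℂ)) volume a b :=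
    (hec.mul (Complex.continuous_ofReal.comp_continuousOn hu'c)).intervalIntegrable
  have hFTC := intervalIntegral.integral_eq_sub_of_hasDerivAt
    (f := fun x => Complex.exp (Complex.I * (ψ x : ℂ)) * (u x : ℂ))
    (f' := fun x => Complex.I * (Complex.exp (Complex.I * (ψ x : ℂ)) * ((ψ' x * u x : ℝ) : ℂ)) +
      Complex.exp (Complex.I * (ψ x : ℂ)) * (u' x : ℂ))
    (fun x hx =>
      (((hψ x hx).ofReal_comp.const_mul Complex.I).cexp.mul (hu x hx).ofReal_comp).congr_deriv
        (by push_cast; ring)) ((h1.const_mul _).add h2)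
  rw [intervalIntegral.integral_add (h1.const_mul _) h2, intervalIntegral.integral_const_mul] at hFTC
  simp only [ha, hb, Complex.ofReal_zero, mul_zero, sub_self] at hFTC
  linear_combination (-Complex.I) * hFTC + (∫ x in a..b,
    Complex.exp (Complex.I * (ψ x : ℂ)) * ((ψ' x * u x : ℝ) : ℂ)) * Complex.I_sq

/-- Non-stationary phase: two integrations by parts in the first frequency variable. -/
theorem exists_norm_integral_nonstationary_le {χ : ℝ → ℝ} (hχ : ContDiff ℝ (⊤ : ℕ∞) χ)
    (hs : ∀ x : ℝ, 4 ≤ |x| → χ x = 0) :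
    ∃ C : ℝ, 0 ≤ C ∧ ∀ X σ r : ℝ, X ≠ 0 → |σ| ≤ 1 / 250 → 0 ≤ r → r ≤ 50 →
      ‖∫ ξ : ℝ, Complex.exp (Complex.I * ((X * (ξ + σ * (ξ ^ 3 + r * ξ)) : ℝ) : ℂ)) * (χ ξ : ℂ)‖
        ≤ C * (X ^ 2)⁻¹ := by
  have hχ1 : ContDiff ℝ 1 (deriv χ) := (contDiff_infty_iff_deriv.1 hχ).2.of_le (by simp)
  have hd0 : ∀ x, HasDerivAt χ (deriv χ x) x := fun x =>
    (hχ.differentiable (by simp)).differentiableAt.hasDerivAt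
  have hd1 : ∀ x, HasDerivAt (deriv χ) (deriv (deriv χ) x) x := fun x =>
    (hχ1.differentiable (by simp)).differentiableAt.hasDerivAt
  have hc0 : Continuous χ := hχ.continuous
  have hc1 : Continuous (deriv χ) := hχ1.continuous
  have hc2 : Continuous (deriv (deriv χ)) := hχ1.continuous_deriv le_rfl
  have hz : ∀ x : ℝ, 4 < |x| → χ x = 0 ∧ deriv χ x = 0 := by
    intro x hx
    refine ⟨hs x hx.le, ?_⟩
    have : χ =ᶠ[nhds x] fun _ => 0 := by
      filter_upwards [continuous_abs.continuousAt.eventually (lt_mem_nhds hx)] with y hy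
      exact hs y hy.le
    rw [this.deriv_eq]
    simp
  obtain ⟨A0, hA0⟩ := (isCompact_Icc (a := (-5 : ℝ)) (b := 5)).exists_bound_of_continuousOn
    hc0.continuousOn
  obtain ⟨A1, hA1⟩ := (isCompact_Icc (a := (-5 : ℝ)) (b := 5)).exists_bound_of_continuousOn
    hc1.continuousOn
  obtain ⟨A2, hA2⟩ := (isCompact_Icc (a := (-5 : ℝ)) (b := 5)).exists_bound_of_continuousOn
    hc2.continuousOn
  set A : ℝ := |A0| + |A1| + |A2|
  have hAnn : 0 ≤ A := by positivity
  have hB0 : ∀ x ∈ Set.Icc (-5 : ℝ) 5, |χ x| ≤ A := fun x hx =>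
    (hA0 x hx).trans (by linarith [le_abs_self A0, abs_nonneg A1, abs_nonneg A2])
  have hB1 : ∀ x ∈ Set.Icc (-5 : ℝ) 5, |deriv χ x| ≤ A := fun x hx =>
    (hA1 x hx).trans (by linarith [le_abs_self A1, abs_nonneg A0, abs_nonneg A2])
  have hB2 : ∀ x ∈ Set.Icc (-5 : ℝ) 5, |deriv (deriv χ) x| ≤ A := fun x hx =>
    (hA2 x hx).trans (by linarith [le_abs_self A2, abs_nonneg A1, abs_nonneg A0])
  refine ⟨1800 * A, by positivity, fun X σ r hX hσ hr0 hr => ?_⟩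
  have hIcc : Set.uIcc (-5 : ℝ) 5 = Set.Icc (-5) 5 := Set.uIcc_of_le (by norm_num)
  set ψ : ℝ → ℝ := fun ξ => X * (ξ + σ * (ξ ^ 3 + r * ξ)) with hψ
  set d : ℝ → ℝ := fun ξ => 1 + σ * (3 * ξ ^ 2 + r) with hd
  have hdlow : ∀ x ∈ Set.Icc (-5 : ℝ) 5, |d x - 1| ≤ 1 / 2 := by
    intro x hx
    have h25 : x ^ 2 ≤ 25 := by nlinarith [hx.1, hx.2]
    have : |d x - 1| = |σ| * (3 * x ^ 2 + r) := by
      simp only [hd, add_sub_cancel_left, abs_mul]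
      rw [abs_of_nonneg (by positivity : 0 ≤ 3 * x ^ 2 + r)]
    rw [this]
    nlinarith [abs_nonneg σ, sq_nonneg x]
  have hdpos : ∀ x ∈ Set.Icc (-5 : ℝ) 5, 1 / 2 ≤ d x := fun x hx => by
    linarith [(abs_le.1 (hdlow x hx)).1]
  have hdne : ∀ x ∈ Set.Icc (-5 : ℝ) 5, d x ≠ 0 := fun x hx => by
    linarith [hdpos x hx] |> ne_of_gt
  have hdd : ∀ x, HasDerivAt d (6 * σ * x) x := by
    intro x
    have h := ((((hasDerivAt_id' x).pow 2).const_mul 3).add_const r).const_mul σ |>.const_add 1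
    exact h.congr_deriv (by simp; ring)
  have hdc : Continuous d := by fun_prop
  have hψd : ∀ x, HasDerivAt ψ (X * d x) x := by
    intro x
    have h := ((hasDerivAt_id' x).add ((((hasDerivAt_id' x).pow 3).add
      ((hasDerivAt_id' x).const_mul r)).const_mul σ)).const_mul X
    exact h.congr_deriv (by simp [hd])
  set n : ℝ → ℝ := fun x => deriv χ x * d x - χ x * (6 * σ * x) with hn
  set m : ℝ → ℝ := fun x => (deriv (deriv χ) x * d x - 6 * σ * χ x) * d x -
    3 * n x * (6 * σ * x) with hm
  have hnd : ∀ x, HasDerivAt n (deriv (deriv χ) x * d x - 6 * σ * χ x) x := by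
    intro x
    have h := ((hd1 x).mul (hdd x)).sub ((hd0 x).mul ((hasDerivAt_id' x).const_mul (6 * σ)))
    exact h.congr_deriv (by simp; ring)
  have hu1 : ∀ x ∈ Set.Icc (-5 : ℝ) 5,
      HasDerivAt (fun x => χ x / d x / X) (n x / d x ^ 2 / X) x := fun x hx =>
    ((hd0 x).div (hdd x) (hdne x hx)).div_const X
  have hu2 : ∀ x ∈ Set.Icc (-5 : ℝ) 5,
      HasDerivAt (fun x => n x / d x ^ 3 / X) (m x / d x ^ 4 / X) x := by
    intro x hx
    have hne := hdne x hx
    have h := ((hnd x).div ((hdd x).pow 3) (pow_ne_zero 3 hne)).div_const X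
    refine h.congr_deriv ?_
    simp only [hm, Pi.pow_apply]
    field_simp
    push_cast
    ring
  have hnc : Continuous n := by fun_prop
  have hmc : Continuous m := by fun_prop
  have h5 : 4 < |(5 : ℝ)| ∧ 4 < |(-5 : ℝ)| := by norm_num
  have step1 := intervalIntegral_cexp_mul_deriv_phase (a := -5) (b := 5) (fun x _ => hψd x)
    (hIcc ▸ hu1) (by fun_prop)
    (hIcc ▸ ((hnc.continuousOn.div (hdc.pow 2).continuousOn
      fun x hx => pow_ne_zero 2 (hdne x hx)).div_const X))
    (by simp [hz _ h5.2]) (by simp [hz _ h5.1])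
  have step2 := intervalIntegral_cexp_mul_deriv_phase (a := -5) (b := 5) (fun x _ => hψd x)
    (hIcc ▸ hu2) (by fun_prop)
    (hIcc ▸ ((hmc.continuousOn.div (hdc.pow 4).continuousOn
      fun x hx => pow_ne_zero 4 (hdne x hx)).div_const X))
    (by simp [hn, hz _ h5.2]) (by simp [hn, hz _ h5.1])
  have e1 : ∫ x in (-5 : ℝ)..5, Complex.exp (Complex.I * (ψ x : ℂ)) * (χ x : ℂ) =
      ∫ x in (-5 : ℝ)..5, Complex.exp (Complex.I * (ψ x : ℂ)) *
        ((X * d x * (χ x / d x / X) : ℝ) : ℂ) := by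
    refine intervalIntegral.integral_congr fun x hx => ?_
    have hne := hdne x (hIcc ▸ hx)
    congr 2
    field_simp
  have e2 : ∫ x in (-5 : ℝ)..5, Complex.exp (Complex.I * (ψ x : ℂ)) *
        ((n x / d x ^ 2 / X : ℝ) : ℂ) =
      (X : ℂ)⁻¹ * ∫ x in (-5 : ℝ)..5, Complex.exp (Complex.I * (ψ x : ℂ)) *
        ((X * d x * (n x / d x ^ 3 / X) : ℝ) : ℂ) := by
    rw [← intervalIntegral.integral_const_mul]
    refine intervalIntegral.integral_congr fun x hx => ?_
    have hne : (d x : ℂ) ≠ 0 := by exact_mod_cast hdne x (hIcc ▸ hx)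
    have hX' : (X : ℂ) ≠ 0 := by exact_mod_cast hX
    push_cast
    field_simp
  have e0 : ∫ ξ : ℝ, Complex.exp (Complex.I * (ψ ξ : ℂ)) * (χ ξ : ℂ) =
      ∫ x in (-5 : ℝ)..5, Complex.exp (Complex.I * (ψ x : ℂ)) * (χ x : ℂ) := by
    rw [intervalIntegral.integral_eq_integral_of_support_subset]
    intro x hx
    by_contra hcon
    refine hx ?_
    have : 4 ≤ |x| := by
      by_contra! h
      have := abs_lt.1 h
      exact hcon ⟨by linarith, by linarith⟩
    simp [hs x this]
  have hbound : ‖∫ x in (-5 : ℝ)..5, Complex.exp (Complex.I * (ψ x : ℂ)) *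
      ((m x / d x ^ 4 / X : ℝ) : ℂ)‖ ≤ (180 * A * |X|⁻¹) * |(5 : ℝ) - (-5)| := by
    refine intervalIntegral.norm_integral_le_of_norm_le_const fun x hx => ?_
    have hx' : x ∈ Set.Icc (-5 : ℝ) 5 := by
      rw [← hIcc]; exact Set.uIoc_subset_uIcc hx
    rw [norm_mul, mul_comm Complex.I, Complex.norm_exp_ofReal_mul_I, one_mul, Complex.norm_real,
      Real.norm_eq_abs, abs_div, abs_div, div_eq_mul_inv _ |X|]
    gcongr
    have hd4 : 1 / 16 ≤ |d x ^ 4| := by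
      rw [abs_of_nonneg (by positivity)]
      calc (1 / 16 : ℝ) = (1 / 2) ^ 4 := by norm_num
        _ ≤ d x ^ 4 := by gcongr; exact hdpos x hx'
    have hdu : |d x| ≤ 3 / 2 := by
      have := abs_le.1 (hdlow x hx')
      exact abs_le.2 ⟨by linarith, by linarith⟩
    have hσx : |6 * σ * x| ≤ 1 := by
      have : |x| ≤ 5 := abs_le.2 hx'
      rw [abs_mul, abs_mul, abs_of_pos (by norm_num : (0 : ℝ) < 6)]
      nlinarith [abs_nonneg σ, abs_nonneg x]
    have hσ6 : |6 * σ| ≤ 1 := by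
      rw [abs_mul, abs_of_pos (by norm_num : (0 : ℝ) < 6)]
      linarith
    have hnb : |n x| ≤ 5 / 2 * A := by
      calc |n x| ≤ |deriv χ x| * |d x| + |χ x| * |6 * σ * x| := by
            rw [← abs_mul, ← abs_mul]; exact abs_sub _ _
        _ ≤ A * (3 / 2) + A * 1 := by
            gcongr
            exacts [hB1 x hx', hB0 x hx']
        _ = _ := by ring
    have hmb : |m x| ≤ 45 / 4 * A := by
      calc |m x| ≤ (|deriv (deriv χ) x| * |d x| + |6 * σ| * |χ x|) * |d x| +
            3 * |n x| * |6 * σ * x| := by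
            refine (abs_sub _ _).trans ?_
            rw [abs_mul, abs_mul, abs_mul 3, abs_of_pos (by norm_num : (0 : ℝ) < 3)]
            gcongr
            rw [← abs_mul, ← abs_mul]
            exact abs_sub _ _
        _ ≤ (A * (3 / 2) + 1 * A) * (3 / 2) + 3 * (5 / 2 * A) * 1 := by
            gcongr
            exacts [hB2 x hx', hB0 x hx']
        _ = _ := by ring
    rw [div_le_iff₀ (by linarith)]
    nlinarith
  rw [e0, e1, step1, e2, step2, norm_mul, norm_mul, norm_mul, Complex.norm_I, norm_inv,
    Complex.norm_real, Real.norm_eq_abs, one_mul, one_mul]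
  calc _ ≤ |X|⁻¹ * ((180 * A * |X|⁻¹) * |(5 : ℝ) - (-5)|) := by gcongr
    _ = 1800 * A * (X ^ 2)⁻¹ := by
      rw [← sq_abs X, show |(5 : ℝ) - (-5)| = 10 by norm_num, pow_two, mul_inv]
      ring

theorem hasCompactSupport_of_forall_le_abs {χ : ℝ → ℝ} {R : ℝ} (hs : ∀ x : ℝ, R ≤ |x| → χ x = 0) :
    HasCompactSupport χ :=
  HasCompactSupport.of_support_subset_isCompact (isCompact_closedBall (0 : ℝ) R) fun x hx => by
    rw [mem_closedBall_zero_iff, Real.norm_eq_abs]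
    by_contra! h
    exact hx (hs x h.le)

section OscillatoryIntegral

variable {χ₁ χ₂ χ₃ : ℝ → ℝ}

theorem norm_oscI_integrand (s : ℝ) (x ξ : ℝ × ℝ × ℝ) :
    ‖Complex.exp (Complex.I * ((dot3 x ξ + s * omega3 ξ : ℝ) : ℂ)) *
      ((χ₁ ξ.1 * χ₂ ξ.2.1 * χ₃ ξ.2.2 : ℝ) : ℂ)‖ = |χ₁ ξ.1| * (|χ₂ ξ.2.1| * |χ₃ ξ.2.2|) := by
  rw [norm_mul, mul_comm Complex.I, Complex.norm_exp_ofReal_mul_I, one_mul, Complex.norm_real,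
    Real.norm_eq_abs, abs_mul, abs_mul, mul_assoc]

theorem integrable_oscI_integrand (h₁ : Integrable χ₁) (h₂ : Integrable χ₂) (h₃ : Integrable χ₃)
    (s : ℝ) (x : ℝ × ℝ × ℝ) :
    Integrable fun ξ : ℝ × ℝ × ℝ =>
      Complex.exp (Complex.I * ((dot3 x ξ + s * omega3 ξ : ℝ) : ℂ)) *
        ((χ₁ ξ.1 * χ₂ ξ.2.1 * χ₃ ξ.2.2 : ℝ) : ℂ) := by
  have hprod : Integrable fun ξ : ℝ × ℝ × ℝ => χ₁ ξ.1 * χ₂ ξ.2.1 * χ₃ ξ.2.2 := by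
    simp only [mul_assoc]
    exact h₁.mul_prod (h₂.mul_prod h₃)
  refine hprod.ofReal.bdd_mul (c := 1) (Continuous.aestronglyMeasurable ?_)
    (.of_forall fun ξ => ?_)
  · unfold dot3 omega3
    fun_prop
  · rw [mul_comm Complex.I, Complex.norm_exp_ofReal_mul_I]

theorem exists_norm_oscI_le (h₁ : Integrable χ₁) (h₂ : Integrable χ₂) (h₃ : Integrable χ₃) :
    ∃ C : ℝ, 0 ≤ C ∧ ∀ (s : ℝ) (x : ℝ × ℝ × ℝ), ‖oscI χ₁ χ₂ χ₃ s x‖ ≤ C := by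
  refine ⟨∫ ξ : ℝ × ℝ × ℝ, |χ₁ ξ.1| * (|χ₂ ξ.2.1| * |χ₃ ξ.2.2|), by positivity, fun s x => ?_⟩
  exact norm_integral_le_of_norm_le (h₁.abs.mul_prod (h₂.abs.mul_prod h₃.abs))
    (.of_forall fun ξ => (norm_oscI_integrand s x ξ).le)

theorem integrable_abs_mul_rpow_neg {χ : ℝ → ℝ} (hχ : Continuous χ) (hs : HasCompactSupport χ)
    {α : ℝ} (hα : α < 1) : Integrable fun ξ : ℝ => |χ ξ| * |ξ| ^ (-α) := by
  have hloc : LocallyIntegrable (fun ξ : ℝ => |ξ| ^ (-α)) volume :=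
    locallyIntegrable_of_norm_le_rpow (C := 1) (α := α) (by simp) (by simpa using hα)
      (.of_forall fun ξ => by
        rw [one_mul, Real.norm_eq_abs, Real.norm_eq_abs, abs_of_nonneg (by positivity)])
      (Measurable.aestronglyMeasurable (by fun_prop))
  have := hloc.integrable_smul_left_of_hasCompactSupport hχ.abs hs.norm
  simpa using! this

theorem exists_norm_oscI_le_rpow (hc₁ : Continuous χ₁) (hs₁ : HasCompactSupport χ₁)
    (hc₂ : ContDiff ℝ (⊤ : ℕ∞) χ₂) (hs₂ : HasCompactSupport χ₂)
    (hc₃ : ContDiff ℝ (⊤ : ℕ∞) χ₃) (hs₃ : HasCompactSupport χ₃) {q : ℝ} (hq : 0 < q)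
    (hq1 : q ≤ 1) :
    ∃ C : ℝ, 0 ≤ C ∧ ∀ (s : ℝ) (x : ℝ × ℝ × ℝ), 0 < s →
      ‖oscI χ₁ χ₂ χ₃ s x‖ ≤ C * s ^ (-(1 - q)) := by
  obtain ⟨C₂, hC₂, hK₂⟩ := exists_norm_integral_quadratic_phase_le_rpow hc₂ hs₂
    (θ := (1 - q) / 2) (by linarith) (by linarith)
  obtain ⟨C₃, hC₃, hK₃⟩ := exists_norm_integral_quadratic_phase_le_rpow hc₃ hs₃
    (θ := (1 - q) / 2) (by linarith) (by linarith)
  have hint := integrable_abs_mul_rpow_neg hc₁ hs₁ (α := 1 - q) (by linarith)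
  refine ⟨C₂ * C₃ * ∫ ξ : ℝ, |χ₁ ξ| * |ξ| ^ (-(1 - q)), by positivity, fun s x hs => ?_⟩
  have hfub := integral_prod _ (integrable_oscI_integrand
    (hc₁.integrable_of_hasCompactSupport hs₁)
    (hc₂.continuous.integrable_of_hasCompactSupport hs₂)
    (hc₃.continuous.integrable_of_hasCompactSupport hs₃) s x)
  rw [oscI, Measure.volume_eq_prod, hfub]
  refine (norm_integral_le_of_norm_le (hint.const_mul (C₂ * C₃ * s ^ (-(1 - q)))) ?_).trans_eq
    (by rw [integral_const_mul]; ring)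
  filter_upwards [compl_mem_ae_iff.2 (measure_singleton (0 : ℝ))] with ξ hξ
  have hξ : ξ ≠ 0 := hξ
  have hsplit : ∫ y : ℝ × ℝ, Complex.exp (Complex.I *
        ((dot3 x (ξ, y) + s * omega3 (ξ, y) : ℝ) : ℂ)) * ((χ₁ ξ * χ₂ y.1 * χ₃ y.2 : ℝ) : ℂ) =
      (Complex.exp (Complex.I * ((x.1 * ξ + s * ξ ^ 3 : ℝ) : ℂ)) * (χ₁ ξ : ℂ)) *
      ((∫ η : ℝ, Complex.exp (Complex.I * ((x.2.1 * η + s * ξ * η ^ 2 : ℝ) : ℂ)) * (χ₂ η : ℂ)) *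
      ∫ μ : ℝ, Complex.exp (Complex.I * ((x.2.2 * μ + s * ξ * μ ^ 2 : ℝ) : ℂ)) * (χ₃ μ : ℂ)) := by
    rw [← integral_prod_mul, ← integral_const_mul, Measure.volume_eq_prod]
    refine integral_congr_ae (.of_forall fun y => ?_)
    have hexp : Complex.exp (Complex.I * ((dot3 x (ξ, y) + s * omega3 (ξ, y) : ℝ) : ℂ)) =
        Complex.exp (Complex.I * ((x.1 * ξ + s * ξ ^ 3 : ℝ) : ℂ)) *
        (Complex.exp (Complex.I * ((x.2.1 * y.1 + s * ξ * y.1 ^ 2 : ℝ) : ℂ)) *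
        Complex.exp (Complex.I * ((x.2.2 * y.2 + s * ξ * y.2 ^ 2 : ℝ) : ℂ))) := by
      rw [← Complex.exp_add, ← Complex.exp_add, dot3, omega3]
      congr 1
      push_cast
      ring
    simp only [hexp]
    push_cast
    ring
  have hsξ : s * ξ ≠ 0 := mul_ne_zero hs.ne' hξ
  have hpow : |s * ξ| ^ (-((1 - q) / 2)) * |s * ξ| ^ (-((1 - q) / 2)) =
      s ^ (-(1 - q)) * |ξ| ^ (-(1 - q)) := by
    rw [← Real.rpow_add (abs_pos.2 hsξ), abs_mul, abs_of_pos hs,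
      Real.mul_rpow hs.le (abs_nonneg ξ)]
    ring_nf
  simp only [hsplit]
  rw [norm_mul, norm_mul, norm_mul, mul_comm Complex.I, Complex.norm_exp_ofReal_mul_I, one_mul,
    Complex.norm_real, Real.norm_eq_abs]
  calc _ ≤ |χ₁ ξ| * ((C₂ * |s * ξ| ^ (-((1 - q) / 2))) * (C₃ * |s * ξ| ^ (-((1 - q) / 2)))) := by
        gcongr
        exacts [hK₂ _ _ hsξ, hK₃ _ _ hsξ]
    _ = |χ₁ ξ| * (C₂ * C₃) * (|s * ξ| ^ (-((1 - q) / 2)) * |s * ξ| ^ (-((1 - q) / 2))) := by ring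
    _ = _ := by rw [hpow]; ring

theorem exists_norm_oscI_le_inv_sq (hc₁ : ContDiff ℝ (⊤ : ℕ∞) χ₁)
    (hs₁ : ∀ x : ℝ, 4 ≤ |x| → χ₁ x = 0)
    (hc₂ : Continuous χ₂) (hs₂ : ∀ x : ℝ, 4 ≤ |x| → χ₂ x = 0)
    (hc₃ : Continuous χ₃) (hs₃ : ∀ x : ℝ, 4 ≤ |x| → χ₃ x = 0) :
    ∃ C : ℝ, 0 ≤ C ∧ ∀ (s : ℝ) (x : ℝ × ℝ × ℝ), x.1 ≠ 0 → 250 * |s| ≤ |x.1| →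
      ‖oscI χ₁ χ₂ χ₃ s x‖ ≤ C * (x.1 ^ 2)⁻¹ := by
  obtain ⟨C, hC, hK⟩ := exists_norm_integral_nonstationary_le hc₁ hs₁
  have hi₁ := hc₁.continuous.integrable_of_hasCompactSupport (μ := volume)
    (hasCompactSupport_of_forall_le_abs hs₁)
  have hi₂ := hc₂.integrable_of_hasCompactSupport (μ := volume)
    (hasCompactSupport_of_forall_le_abs hs₂)
  have hi₃ := hc₃.integrable_of_hasCompactSupport (μ := volume)
    (hasCompactSupport_of_forall_le_abs hs₃)
  refine ⟨C * ∫ y : ℝ × ℝ, |χ₂ y.1| * |χ₃ y.2|, by positivity, fun s x hx hsx => ?_⟩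
  have hfub := integral_prod_symm _ (integrable_oscI_integrand hi₁ hi₂ hi₃ s x)
  rw [oscI, Measure.volume_eq_prod, hfub, mul_right_comm, ← integral_const_mul]
  refine norm_integral_le_of_norm_le ((hi₂.abs.mul_prod hi₃.abs).const_mul _)
    (.of_forall fun y => ?_)
  have hsplit : ∫ ξ : ℝ, Complex.exp (Complex.I *
        ((dot3 x (ξ, y) + s * omega3 (ξ, y) : ℝ) : ℂ)) * ((χ₁ ξ * χ₂ y.1 * χ₃ y.2 : ℝ) : ℂ) =
      (Complex.exp (Complex.I * ((x.2.1 * y.1 + x.2.2 * y.2 : ℝ) : ℂ)) *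
        ((χ₂ y.1 * χ₃ y.2 : ℝ) : ℂ)) *
      ∫ ξ : ℝ, Complex.exp (Complex.I *
        ((x.1 * (ξ + s / x.1 * (ξ ^ 3 + (y.1 ^ 2 + y.2 ^ 2) * ξ)) : ℝ) : ℂ)) * (χ₁ ξ : ℂ) := by
    rw [← integral_const_mul]
    refine integral_congr_ae (.of_forall fun ξ => ?_)
    have hexp : Complex.exp (Complex.I * ((dot3 x (ξ, y) + s * omega3 (ξ, y) : ℝ) : ℂ)) =
        Complex.exp (Complex.I * ((x.2.1 * y.1 + x.2.2 * y.2 : ℝ) : ℂ)) *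
        Complex.exp (Complex.I *
        ((x.1 * (ξ + s / x.1 * (ξ ^ 3 + (y.1 ^ 2 + y.2 ^ 2) * ξ)) : ℝ) : ℂ)) := by
      rw [← Complex.exp_add, ← mul_add, ← Complex.ofReal_add, dot3, omega3]
      congr 3
      field_simp
      ring
    simp only [hexp]
    push_cast
    ring
  simp only [hsplit]
  rw [norm_mul, norm_mul, mul_comm Complex.I, Complex.norm_exp_ofReal_mul_I, one_mul,
    Complex.norm_real, Real.norm_eq_abs, abs_mul, mul_comm]
  by_cases hy : |y.1| < 4 ∧ |y.2| < 4
  · have h1 := abs_lt.1 hy.1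
    have h2 := abs_lt.1 hy.2
    gcongr
    refine hK _ _ _ hx ?_ (by positivity) (by nlinarith)
    rw [abs_div, div_le_iff₀ (abs_pos.2 hx)]
    linarith
  · have h0 : |χ₂ y.1| * |χ₃ y.2| = 0 := by
      by_cases h1 : |y.1| < 4
      · rw [hs₃ _ (not_lt.1 fun h2 => hy ⟨h1, h2⟩)]; simp
      · rw [hs₂ _ (not_lt.1 h1)]; simp
    rw [h0]
    simp

/-- Combined kernel bound: the supremum over `|s| ≤ M` and the transversal variables is dominated
by an integrable function of the first variable, with an `M ^ (2 q)` loss. -/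
theorem exists_norm_oscI_le_one_add_rpow (hc₁ : ContDiff ℝ (⊤ : ℕ∞) χ₁)
    (hs₁ : ∀ x : ℝ, 4 ≤ |x| → χ₁ x = 0)
    (hc₂ : ContDiff ℝ (⊤ : ℕ∞) χ₂) (hs₂ : ∀ x : ℝ, 4 ≤ |x| → χ₂ x = 0)
    (hc₃ : ContDiff ℝ (⊤ : ℕ∞) χ₃) (hs₃ : ∀ x : ℝ, 4 ≤ |x| → χ₃ x = 0)
    {q : ℝ} (hq : 0 < q) (hq1 : q ≤ 1) :
    ∃ C : ℝ, 0 ≤ C ∧ ∀ (M s : ℝ) (x : ℝ × ℝ × ℝ), 1 ≤ M → 0 ≤ s → s ≤ M →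
      ‖oscI χ₁ χ₂ χ₃ s x‖ ≤ C * M ^ (2 * q) * (1 + |x.1|) ^ (-(1 + q)) := by
  have hcs₁ := hasCompactSupport_of_forall_le_abs hs₁
  have hcs₂ := hasCompactSupport_of_forall_le_abs hs₂
  have hcs₃ := hasCompactSupport_of_forall_le_abs hs₃
  obtain ⟨A, hA0, hA⟩ := exists_norm_oscI_le
    (hc₁.continuous.integrable_of_hasCompactSupport hcs₁)
    (hc₂.continuous.integrable_of_hasCompactSupport hcs₂)
    (hc₃.continuous.integrable_of_hasCompactSupport hcs₃)
  obtain ⟨B, hB0, hB⟩ := exists_norm_oscI_le_rpow hc₁.continuous hcs₁ hc₂ hcs₂ hc₃ hcs₃ hq hq1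
  obtain ⟨D, hD0, hD⟩ := exists_norm_oscI_le_inv_sq hc₁ hs₁ hc₂.continuous hs₂ hc₃.continuous hs₃
  refine ⟨4 * A + 4 * D + B * 500 ^ (1 + q), by positivity, fun M s x hM hs hsM => ?_⟩
  have hM1 : 1 ≤ M ^ (2 * q) := Real.one_le_rpow hM (by positivity)
  have hcomp : ∀ E : ℝ, 0 ≤ E → E ≤ 4 * A + 4 * D + B * 500 ^ (1 + q) →
      E * (1 + |x.1|) ^ (-(1 + q)) ≤
        (4 * A + 4 * D + B * 500 ^ (1 + q)) * M ^ (2 * q) * (1 + |x.1|) ^ (-(1 + q)) := by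
    intro E hE hle
    gcongr
    nlinarith
  have hBp : 0 ≤ B * (500 : ℝ) ^ (1 + q) := by positivity
  rcases le_total |x.1| 1 with hx1 | hx1
  · refine (hA s x).trans (le_trans ?_ (hcomp (4 * A) (by positivity) (by linarith)))
    have : (1 / 4 : ℝ) ≤ (1 + |x.1|) ^ (-(1 + q)) := by
      calc (1 / 4 : ℝ) = (2 : ℝ) ^ (-2 : ℝ) := by
            rw [Real.rpow_neg (by norm_num), Real.rpow_two]; norm_num
        _ ≤ (2 : ℝ) ^ (-(1 + q)) := Real.rpow_le_rpow_of_exponent_le (by norm_num) (by linarith)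
        _ ≤ (1 + |x.1|) ^ (-(1 + q)) :=
            Real.rpow_le_rpow_of_nonpos (by positivity) (by linarith) (by linarith)
    nlinarith
  have hx0 : x.1 ≠ 0 := abs_pos.1 (by linarith)
  rcases le_total (250 * |s|) |x.1| with hcase | hcase
  · refine (hD s x hx0 hcase).trans (le_trans ?_ (hcomp (4 * D) (by positivity) (by linarith)))
    have h1 : (x.1 ^ 2)⁻¹ ≤ 4 * (1 + |x.1|) ^ (-(1 + q)) := by
      calc (x.1 ^ 2)⁻¹ ≤ 4 * ((1 + |x.1|) ^ 2)⁻¹ := by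
            rw [← sq_abs, ← div_eq_mul_inv, inv_eq_one_div, div_le_div_iff₀ (by positivity)
              (by positivity)]
            nlinarith
        _ = 4 * (1 + |x.1|) ^ (-2 : ℝ) := by
            rw [Real.rpow_neg (by positivity), Real.rpow_two]
        _ ≤ _ := by
            gcongr
            exacts [by linarith, by linarith]
    nlinarith
  · rw [abs_of_nonneg hs] at hcase
    set w : ℝ := (1 + |x.1|) / 500 with hw
    have hw0 : 0 < w := by positivity
    have hws : w ≤ s := by rw [hw]; linarith
    have hs0 : 0 < s := hw0.trans_le hws
    refine (hB s x hs0).trans ?_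
    have h1 : s ^ (-(1 - q)) ≤ 500 ^ (1 + q) * M ^ (2 * q) * (1 + |x.1|) ^ (-(1 + q)) := by
      calc s ^ (-(1 - q)) ≤ w ^ (-(1 - q)) :=
            Real.rpow_le_rpow_of_nonpos hw0 hws (by linarith)
        _ = w ^ (-(1 + q)) * w ^ (2 * q) := by
            rw [← Real.rpow_add hw0]; ring_nf
        _ ≤ w ^ (-(1 + q)) * M ^ (2 * q) := by
            gcongr
            linarith
        _ = _ := by
            rw [hw, Real.div_rpow (by positivity) (by norm_num), Real.rpow_neg (x := 500) (by norm_num)]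
            field_simp
    calc B * s ^ (-(1 - q)) ≤ B * (500 ^ (1 + q) * M ^ (2 * q) * (1 + |x.1|) ^ (-(1 + q))) := by
          gcongr
      _ = (B * 500 ^ (1 + q)) * M ^ (2 * q) * (1 + |x.1|) ^ (-(1 + q)) := by ring
      _ ≤ _ := by
          gcongr
          linarith

/-- Rescaling all three frequencies by `N`. -/
theorem oscI_comp_inv_mul {N : ℝ} (hN : 0 < N) (t : ℝ) (x : ℝ × ℝ × ℝ) :
    oscI (fun ξ => χ₁ (N⁻¹ * ξ)) (fun ξ => χ₂ (N⁻¹ * ξ)) (fun ξ => χ₃ (N⁻¹ * ξ)) t x =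
      ((N ^ 3 : ℝ) : ℂ) * oscI χ₁ χ₂ χ₃ (N ^ 3 * t) (N • x) := by
  have : (volume : Measure (ℝ × ℝ)).IsAddHaarMeasure := by
    rw [Measure.volume_eq_prod]; infer_instance
  have : (volume : Measure (ℝ × ℝ × ℝ)).IsAddHaarMeasure := by
    rw [Measure.volume_eq_prod]; infer_instance
  have h := Measure.integral_comp_inv_smul_of_nonneg (volume : Measure (ℝ × ℝ × ℝ))
    (fun ξ : ℝ × ℝ × ℝ =>
      Complex.exp (Complex.I * ((dot3 (N • x) ξ + N ^ 3 * t * omega3 ξ : ℝ) : ℂ)) *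
        ((χ₁ ξ.1 * χ₂ ξ.2.1 * χ₃ ξ.2.2 : ℝ) : ℂ)) hN.le
  have hfin : Module.finrank ℝ (ℝ × ℝ × ℝ) = 3 := by simp
  rw [hfin] at h
  rw [oscI, oscI, ← smul_eq_mul, Complex.coe_smul, ← h]
  refine integral_congr_ae (.of_forall fun ξ => ?_)
  simp only [dot3, omega3, Prod.smul_fst, Prod.smul_snd, smul_eq_mul]
  congr 4
  field_simp

/-- The maximal kernel estimate for frequency cutoffs rescaled by `N ≥ 1`. -/
theorem exists_integral_iSup_norm_oscI_le (hc₁ : ContDiff ℝ (⊤ : ℕ∞) χ₁)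
    (hs₁ : ∀ x : ℝ, 4 ≤ |x| → χ₁ x = 0)
    (hc₂ : ContDiff ℝ (⊤ : ℕ∞) χ₂) (hs₂ : ∀ x : ℝ, 4 ≤ |x| → χ₂ x = 0)
    (hc₃ : ContDiff ℝ (⊤ : ℕ∞) χ₃) (hs₃ : ∀ x : ℝ, 4 ≤ |x| → χ₃ x = 0)
    {ε : ℝ} (hε : 0 < ε) :
    ∃ C : ℝ, 0 ≤ C ∧ ∀ T N : ℝ, T ≤ 1 → 1 ≤ N →
      (∫ x : ℝ, ⨆ (y : ℝ) (z : ℝ) (t : Set.Icc (0 : ℝ) T),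
        ‖oscI (fun ξ => χ₁ (N⁻¹ * ξ)) (fun ξ => χ₂ (N⁻¹ * ξ)) (fun ξ => χ₃ (N⁻¹ * ξ))
          (t : ℝ) (x, y, z)‖) ≤ C * N ^ (2 + ε) := by
  set q : ℝ := min (ε / 6) 1
  have hq : 0 < q := by positivity
  have hq6 : 6 * q ≤ ε := by linarith [min_le_left (ε / 6) 1]
  obtain ⟨C, hC0, hC⟩ :=
    exists_norm_oscI_le_one_add_rpow hc₁ hs₁ hc₂ hs₂ hc₃ hs₃ hq (min_le_right _ _)
  have hG : Integrable fun X : ℝ => (1 + |X|) ^ (-(1 + q)) := by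
    simpa using integrable_one_add_norm (E := ℝ) (μ := volume) (r := 1 + q) (by simpa using hq)
  have hJ : 0 ≤ ∫ X : ℝ, (1 + |X|) ^ (-(1 + q)) := by positivity
  refine ⟨C * ∫ X : ℝ, (1 + |X|) ^ (-(1 + q)), by positivity, fun T N hT hN => ?_⟩
  have hN0 : 0 < N := by linarith
  have hN3 : 1 ≤ N ^ 3 := one_le_pow₀ hN
  have hpt : ∀ (x y z : ℝ) (t : Set.Icc (0 : ℝ) T),
      ‖oscI (fun ξ => χ₁ (N⁻¹ * ξ)) (fun ξ => χ₂ (N⁻¹ * ξ)) (fun ξ => χ₃ (N⁻¹ * ξ))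
          (t : ℝ) (x, y, z)‖ ≤
        N ^ 3 * (C * (N ^ 3) ^ (2 * q)) * (1 + |N * x|) ^ (-(1 + q)) := by
    intro x y z t
    rw [oscI_comp_inv_mul hN0, norm_mul, Complex.norm_real, Real.norm_of_nonneg (by positivity),
      mul_assoc]
    gcongr
    exact hC (N ^ 3) _ (N • (x, y, z)) hN3 (mul_nonneg (by positivity) t.2.1)
      (mul_le_of_le_one_right (by positivity) (t.2.2.trans hT))
  calc _ ≤ ∫ x : ℝ, N ^ 3 * (C * (N ^ 3) ^ (2 * q)) * (1 + |N * x|) ^ (-(1 + q)) := by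
        refine integral_mono_of_nonneg (.of_forall fun x => ?_)
          ((hG.comp_mul_left' hN0.ne').const_mul _) (.of_forall fun x => ?_)
        · exact Real.iSup_nonneg fun y => Real.iSup_nonneg fun z => Real.iSup_nonneg fun t =>
            norm_nonneg _
        · exact Real.iSup_le (fun y => Real.iSup_le (fun z => Real.iSup_le (fun t => hpt x y z t)
            (by positivity)) (by positivity)) (by positivity)
    _ = N ^ 3 * (C * (N ^ 3) ^ (2 * q)) * (N⁻¹ * ∫ X : ℝ, (1 + |X|) ^ (-(1 + q))) := by
        rw [integral_const_mul, Measure.integral_comp_mul_left (fun X => (1 + |X|) ^ (-(1 + q))) N,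
          abs_of_pos (by positivity), smul_eq_mul]
    _ = (C * ∫ X : ℝ, (1 + |X|) ^ (-(1 + q))) * N ^ (2 + 6 * q) := by
        rw [← Real.rpow_natCast N 3, ← Real.rpow_mul hN0.le, Real.rpow_add hN0,
          show ((3 : ℕ) : ℝ) * (2 * q) = 6 * q by push_cast; ring, Real.rpow_natCast,
          Real.rpow_two]
        field_simp
    _ ≤ _ := by
        gcongr

end OscillatoryIntegral

/-- Unweighted kernel estimate with ε loss:
‖I_k‖_{L¹_x L^∞_{yzT}} ≤ C 2^{(2+ε)k} uniformly in T ∈ (0,1) and k ≥ 0. -/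
theorem Ik_L1x_Linf_yzT_eps
    (p : ℝ → ℝ) (hp_smooth : ContDiff ℝ (⊤ : ℕ∞) p) (hp_nonneg : ∀ ξ, 0 ≤ p ξ)
    (hp_one : ∀ ξ : ℝ, |ξ| ≤ 1 → p ξ = 1) (hp_zero : ∀ ξ : ℝ, 2 ≤ |ξ| → p ξ = 0)
    (ε : ℝ) (hε : 0 < ε) :
    ∃ C : ℝ, 0 < C ∧ ∀ T : ℝ, 0 < T → T < 1 → ∀ k : ℕ, ∀ ψ₁ ψ₂ ψ₃ : ℝ → ℝ,
      ((ψ₁, ψ₂, ψ₃) = (dk1 p k, pk1 p k, pk1 p k) ∨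
       (ψ₁, ψ₂, ψ₃) = (pk1 p k, dk1 p k, pk1 p k) ∨
       (ψ₁, ψ₂, ψ₃) = (pk1 p k, pk1 p k, dk1 p k)) →
      (∫ x : ℝ, ⨆ (y : ℝ) (z : ℝ) (t : Set.Icc (0:ℝ) T),
          ‖oscI ψ₁ ψ₂ ψ₃ (t : ℝ) (x, y, z)‖)
        ≤ C * (2:ℝ) ^ ((2 + ε) * (k : ℝ)) := by
  have hT1 : ContDiff ℝ (⊤ : ℕ∞) (fun ξ : ℝ => p (ξ / 2) - p ξ) := by fun_prop
  have hz1 : ∀ x : ℝ, 4 ≤ |x| → p x = 0 := fun x hx => hp_zero x (by linarith)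
  have hz2 : ∀ x : ℝ, 4 ≤ |x| → p (x / 2) - p x = 0 := by
    intro x hx
    rw [hz1 x hx, hp_zero (x / 2) (by rw [abs_div, abs_two]; linarith), sub_zero]
  obtain ⟨C₁, h₁, H₁⟩ :=
    exists_integral_iSup_norm_oscI_le hT1 hz2 hp_smooth hz1 hp_smooth hz1 hε
  obtain ⟨C₂, h₂, H₂⟩ :=
    exists_integral_iSup_norm_oscI_le hp_smooth hz1 hT1 hz2 hp_smooth hz1 hε
  obtain ⟨C₃, h₃, H₃⟩ :=
    exists_integral_iSup_norm_oscI_le hp_smooth hz1 hp_smooth hz1 hT1 hz2 hε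
  refine ⟨C₁ + C₂ + C₃ + 1, by positivity, fun T _ hT k ψ₁ ψ₂ ψ₃ hψ => ?_⟩
  have hN : (1 : ℝ) ≤ 2 ^ k := one_le_pow₀ (by norm_num)
  have hpk : pk1 p k = fun ξ => p (((2 : ℝ) ^ k)⁻¹ * ξ) := by
    funext ξ
    rw [pk1, zpow_neg, zpow_natCast]
  have hdk : dk1 p k = fun ξ => p (((2 : ℝ) ^ k)⁻¹ * ξ / 2) - p (((2 : ℝ) ^ k)⁻¹ * ξ) := by
    funext ξ
    rw [dk1, zpow_sub₀ two_ne_zero, zpow_neg, zpow_natCast, zpow_one]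
    ring_nf
  have hpow : ((2 : ℝ) ^ k) ^ (2 + ε) = (2 : ℝ) ^ ((2 + ε) * (k : ℝ)) := by
    rw [← Real.rpow_natCast, ← Real.rpow_mul (by norm_num), mul_comm]
  have hle : ∀ C : ℝ, C ≤ C₁ + C₂ + C₃ + 1 → C * ((2 : ℝ) ^ k) ^ (2 + ε) ≤
      (C₁ + C₂ + C₃ + 1) * (2 : ℝ) ^ ((2 + ε) * (k : ℝ)) := by
    intro C hC
    rw [hpow]
    gcongr
  rw [hpk, hdk] at hψ
  rcases hψ with h | h | h <;> obtain ⟨rfl, rfl, rfl⟩ := by simpa only [Prod.mk.injEq] using h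
  · exact (H₁ T _ hT.le hN).trans (hle _ (by linarith))
  · exact (H₂ T _ hT.le hN).trans (hle _ (by linarith))
  · exact (H₃ T _ hT.le hN).trans (hle _ (by linarith))
end
end
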